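/- arXiv:2602.17946 — 7 statements merged into one kernel-verified Lean document; each statement's English description precedes it below -/
import Mathlib

section
/- For any positive integers n and 3 ≤ r ≤ k, if G is a simple graph on n vertices containing no path with k edges, then the number of r-cliques in G is at most the number of r-cliques in the disjoint union of p copies of the complete graph K_k and one copy of K_q, where n = pk + q with 0 ≤ q ≤ k−1; equivalently, the number of r-cliques in G is at most p·C(k,r) + C(q,r). -/
/-- Every vertex sequence of a path of `G` has at most `k` vertices. -/
def PathBound {V : Type*} (G : SimpleGraph V) (k : ℕ) : Prop :=
  ∀ l : List V, l.IsChain G.Adj → l.Nodup → l.length ≤ k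

/-- All cyclic rotations of `l` are vertex sequences of walks of `G`. -/
def CyclicChain {V : Type*} (G : SimpleGraph V) (l : List V) : Prop :=
  ∀ s t : List V, l = s ++ t → (t ++ s).IsChain G.Adj

section Lists

variable {V : Type*} {G : SimpleGraph V}

lemma isChain_reverse_adj {l : List V} (h : l.IsChain G.Adj) : l.reverse.IsChain G.Adj :=
  List.isChain_reverse.2 (h.imp fun _ _ hab => hab.symm)

lemma cyclicChain_of_isChain {l : List V} (h : l.IsChain G.Adj)
    (hc : ∀ x ∈ l.getLast?, ∀ y ∈ l.head?, G.Adj x y) : CyclicChain G l := by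
  rintro s t rfl
  rcases List.eq_nil_or_concat s with rfl | ⟨s', a, rfl⟩
  · simpa using h
  rcases t with _ | ⟨b, t⟩
  · simpa using h
  refine List.IsChain.append h.right_of_append h.left_of_append ?_
  intro x hx y hy
  apply hc x (by simpa using hx)
  cases s' <;> simpa using hy

lemma cyclicChain_singleton (a : V) : CyclicChain G [a] := by
  intro s t h
  have hl : (t ++ s).length = 1 := by
    have := congrArg List.length h
    simp only [List.length_append, List.length_singleton] at this ⊢
    omega
  obtain ⟨b, hb⟩ := List.length_eq_one_iff.1 hl
  rw [hb]
  exact List.isChain_singleton b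

lemma exists_minimal_path {A B : V → Prop} (hG : G.Connected) {a b : V} (ha : A a) (hb : B b)
    (hAB : ∀ v, A v → ¬ B v) :
    ∃ (u : V) (m : List V) (v : V), A u ∧ B v ∧ (u :: (m ++ [v])).IsChain G.Adj ∧
      (u :: (m ++ [v])).Nodup ∧ ∀ z ∈ m, ¬ A z ∧ ¬ B z := by
  classical
  let P : ℕ → Prop := fun n => ∃ l : List V, l.length = n ∧ l.IsChain G.Adj ∧ l.Nodup ∧
    (∃ u, l.head? = some u ∧ A u) ∧ ∃ v, l.getLast? = some v ∧ B v
  have hex : ∃ n, P n := by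
    obtain ⟨w, hw⟩ := (hG.preconnected a b).exists_isPath
    refine ⟨_, w.support, rfl, w.isChain_adj_support, hw.support_nodup, ⟨a, ?_, ha⟩, ⟨b, ?_, hb⟩⟩
    · rw [List.head?_eq_some_head w.support_ne_nil, w.head_support]
    · rw [List.getLast?_eq_some_getLast w.support_ne_nil, w.getLast_support]
  obtain ⟨l, hl, hch, hnd, ⟨u, hu, hAu⟩, v, hv, hBv⟩ := Nat.find_spec hex
  have hmin : ∀ l' : List V, l'.length < l.length → l'.IsChain G.Adj → l'.Nodup →
      (∃ u, l'.head? = some u ∧ A u) → (∃ v, l'.getLast? = some v ∧ B v) → False := by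
    intro l' h1 h2 h3 h4 h5
    exact Nat.find_min hex (hl ▸ h1) ⟨l', rfl, h2, h3, h4, h5⟩
  rcases l with _ | ⟨x, l⟩
  · simp at hu
  obtain rfl : x = u := by simpa using hu
  rcases List.eq_nil_or_concat l with rfl | ⟨m, y, rfl⟩
  · obtain rfl : x = v := by simpa using hv
    exact absurd hBv (hAB _ hAu)
  have hlast : ∀ (a : V) (l : List V) (b : V), (a :: (l ++ [b])).getLast? = some b := by
    intro a l b
    rw [← List.cons_append, List.getLast?_append]
    rfl
  rw [List.concat_eq_append] at hch hnd hv hmin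
  rw [hlast, Option.some_inj] at hv
  subst hv
  refine ⟨x, m, y, hAu, hBv, hch, hnd, ?_⟩
  intro z hz
  obtain ⟨s, t, rfl⟩ := List.append_of_mem hz
  constructor
  · intro hAz
    have hsuf : (z :: (t ++ [y])) <:+ (x :: ((s ++ z :: t) ++ [y])) := ⟨x :: s, by simp⟩
    exact hmin _ (by simp) (hch.suffix hsuf) (hnd.sublist hsuf.sublist) ⟨z, rfl, hAz⟩
      ⟨y, hlast _ _ _, hBv⟩
  · intro hBz
    have hpre : ((x :: s) ++ [z]) <+: (x :: ((s ++ z :: t) ++ [y])) := ⟨t ++ [y], by simp⟩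
    exact hmin _ (by simp) (List.IsChain.left_of_append (l₂ := t ++ [y]) (by simpa using hch)) (hnd.sublist hpre.sublist) ⟨x, rfl, hAu⟩
      ⟨z, hlast _ _ _, hBz⟩

/-- In a connected graph two disjoint cyclic sequences extend to one path through both. -/
lemma PathBound.length_add_length_le {k : ℕ} (hk : PathBound G k) (hG : G.Connected)
    {C D : List V} (hC : CyclicChain G C) (hD : CyclicChain G D) (hCD : (C ++ D).Nodup)
    (hC0 : C ≠ []) (hD0 : D ≠ []) : C.length + D.length ≤ k := by
  obtain ⟨a, ha⟩ := List.exists_mem_of_ne_nil C hC0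
  obtain ⟨b, hb⟩ := List.exists_mem_of_ne_nil D hD0
  have hdis := (List.nodup_append.1 hCD).2.2
  obtain ⟨u, m, v, hu, hv, hch, hnd, hm⟩ :=
    exists_minimal_path (A := (· ∈ C)) (B := (· ∈ D)) hG ha hb
      (fun z h1 h2 => hdis z h1 z h2 rfl)
  obtain ⟨s, t, rfl⟩ := List.append_of_mem hu
  obtain ⟨s', t', rfl⟩ := List.append_of_mem hv
  have h1 : (t ++ s ++ [u]).IsChain G.Adj := by
    have := hC (s ++ [u]) t (by simp)
    simpa using this
  have h2 : (v :: t' ++ s').IsChain G.Adj := hD s' (v :: t') rfl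
  have h3 : (t ++ s ++ (u :: (m ++ [v])) ++ (t' ++ s')).IsChain G.Adj := by
    have h4 : ((t ++ s) ++ [u] ++ (m ++ [v])).IsChain G.Adj :=
      List.IsChain.append_overlap (l₂ := [u]) h1 (by simpa using hch) (by simp)
    have h5 : ((t ++ s ++ [u] ++ m) ++ [v] ++ (t' ++ s')).IsChain G.Adj :=
      List.IsChain.append_overlap (l₂ := [v]) (by simpa using h4) (by simpa using h2) (by simp)
    simpa using h5
  have h6 := hk _ h3 ?_
  · simp at h6 ⊢
    omega
  · have hperm : (t ++ s ++ (u :: (m ++ [v])) ++ (t' ++ s')).Perm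
        (((s ++ u :: t) ++ (s' ++ v :: t')) ++ m) := by
      rw [← Multiset.coe_eq_coe]
      simp only [← Multiset.coe_add, ← Multiset.cons_coe, ← Multiset.singleton_add,
        Multiset.coe_nil, add_zero]
      abel
    rw [hperm.nodup_iff, List.nodup_append]
    refine ⟨hCD, ?_, ?_⟩
    · exact hnd.sublist ((List.sublist_append_left m [v]).trans (List.sublist_cons_self _ _))
    · rintro x hx y hy rfl
      rcases List.mem_append.1 hx with h | h
      · exact (hm x hy).1 h
      · exact (hm x hy).2 h

/-- The cone over `G`, with apex `none`. -/
def coneGraph (G : SimpleGraph V) : SimpleGraph (Option V) where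
  Adj
    | none, none => False
    | none, some _ => True
    | some _, none => True
    | some a, some b => G.Adj a b
  symm := ⟨by
    rintro (_ | a) (_ | b) h
    · exact h
    · trivial
    · trivial
    · exact G.adj_symm h⟩
  loopless := ⟨by
    rintro (_ | a) h
    · exact h
    · exact G.loopless.irrefl a h⟩

@[simp] lemma coneGraph_some_some {a b : V} : (coneGraph G).Adj (some a) (some b) ↔ G.Adj a b :=
  Iff.rfl

@[simp] lemma coneGraph_none_some {a : V} : (coneGraph G).Adj none (some a) := trivial

@[simp] lemma coneGraph_some_none {a : V} : (coneGraph G).Adj (some a) none := trivial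

lemma exists_map_some {l : List (Option V)} (h : none ∉ l) : ∃ l' : List V, l = l'.map some := by
  induction l with
  | nil => exact ⟨[], rfl⟩
  | cons a l ih =>
    simp only [List.mem_cons, not_or] at h
    obtain ⟨l', rfl⟩ := ih h.2
    rcases a with _ | a
    · exact absurd rfl h.1
    · exact ⟨a :: l', rfl⟩

lemma isChain_map_some {l : List V} :
    (l.map some).IsChain (coneGraph G).Adj ↔ l.IsChain G.Adj := by
  rw [List.isChain_map]
  rfl

lemma PathBound.length_le_of_none_notMem {k : ℕ} (hk : PathBound G k) {l : List (Option V)}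
    (h : l.IsChain (coneGraph G).Adj) (hnd : l.Nodup) (h0 : none ∉ l) : l.length ≤ k := by
  obtain ⟨l', rfl⟩ := exists_map_some h0
  rw [List.length_map]
  exact hk l' (isChain_map_some.1 h) (List.Nodup.of_map _ hnd)

lemma PathBound.cyclic_length_le {k : ℕ} (hk : PathBound G k) {l : List (Option V)}
    (h : CyclicChain (coneGraph G) l) (hnd : l.Nodup) : l.length ≤ k + 1 := by
  by_cases h0 : none ∈ l
  · obtain ⟨s, t, rfl⟩ := List.append_of_mem h0
    have h1 : (t ++ (s ++ [none])).IsChain (coneGraph G).Adj := h (s ++ [none]) t (by simp)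
    have hperm : (s ++ none :: t).Perm (none :: (t ++ s)) :=
      List.perm_middle.trans (List.Perm.cons _ List.perm_append_comm)
    rw [hperm.nodup_iff, List.nodup_cons] at hnd
    rw [← List.append_assoc] at h1
    have := hk.length_le_of_none_notMem h1.left_of_append hnd.2 hnd.1
    simp at this ⊢
    omega
  · have := hk.length_le_of_none_notMem (by simpa using h [] l rfl) hnd h0
    omega

end Lists

section Crossing

variable {V : Type*} {G : SimpleGraph V}

/-- The positions of a list occupied by elements of `S`. -/
noncomputable def positions (R : List V) (S : Finset V) : Finset ℕ := by
  classical
  exact {i ∈ Finset.range R.length | ∃ z ∈ S, R[i]? = some z}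

lemma mem_positions {R : List V} {S : Finset V} {i : ℕ} :
    i ∈ positions R S ↔ ∃ z ∈ S, R[i]? = some z := by
  classical
  simp only [positions, Finset.mem_filter, Finset.mem_range, and_iff_right_iff_imp]
  rintro ⟨z, -, hz⟩
  exact (List.getElem?_eq_some_iff.1 hz).1

lemma card_le_card_positions {R : List V} {S : Finset V} (hS : ∀ z ∈ S, z ∈ R) :
    S.card ≤ (positions R S).card := by
  classical
  refine Finset.card_le_card_of_injOn (fun z => R.idxOf z) ?_ ?_
  · intro z hz
    exact mem_positions.2 ⟨z, hz, List.getElem?_idxOf (hS z hz)⟩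
  · intro z hz w _ h
    exact (List.idxOf_inj (hS z hz)).1 h

/-- Pósa's crossing argument. -/
lemma exists_cyclicChain_of_crossing {R : List V} (hch : R.IsChain G.Adj) (hnd : R.Nodup)
    {x y : V} (hx : R.head? = some x) (hy : R.getLast? = some y) {S T : Finset V}
    (hS : ∀ z ∈ S, z ∈ R ∧ G.Adj x z) (hT : ∀ z ∈ T, z ∈ R ∧ G.Adj y z)
    (hcross : ∃ p ∈ positions R T, ∃ q ∈ positions R S, p < q) :
    ∃ C : List V, CyclicChain G C ∧ C.Nodup ∧
      (R.length ≤ C.length ∨ S.card + T.card ≤ C.length) := by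
  classical
  have hex : ∃ d, ∃ p ∈ positions R T, ∃ q ∈ positions R S, p < q ∧ q - p = d := by
    obtain ⟨p, hp, q, hq, h⟩ := hcross
    exact ⟨q - p, p, hp, q, hq, h, rfl⟩
  obtain ⟨p, hp, q, hq, hpq, hd⟩ := Nat.find_spec hex
  have hmin : ∀ p' ∈ positions R T, ∀ q' ∈ positions R S, p' < q' → q - p ≤ q' - p' := by
    intro p' hp' q' hq' h
    rw [hd]
    exact Nat.find_min' hex ⟨p', hp', q', hq', h, rfl⟩
  obtain ⟨u, huT, hu⟩ := mem_positions.1 hp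
  obtain ⟨w, hwS, hw⟩ := mem_positions.1 hq
  have hqR := (List.getElem?_eq_some_iff.1 hw).1
  have hlen : (R.take (p + 1) ++ (R.drop q).reverse).length = p + 1 + (R.length - q) := by
    simp only [List.length_append, List.length_take, List.length_reverse, List.length_drop]
    omega
  refine ⟨R.take (p + 1) ++ (R.drop q).reverse, ?_, ?_, ?_⟩
  · apply cyclicChain_of_isChain
    · refine List.IsChain.append (hch.take _) (isChain_reverse_adj (hch.drop _)) ?_
      intro c hc d hd'
      have h1 : c = u := by
        rw [List.getLast?_take] at hc
        simpa [hu, eq_comm] using hc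
      have h2 : d = y := by
        rw [List.head?_reverse, List.getLast?_drop, if_neg (by omega), hy] at hd'
        simpa [eq_comm] using hd'
      subst h1 h2
      exact (hT _ huT).2.symm
    · intro c hc d hd'
      have h1 : c = w := by
        rw [List.getLast?_append, List.getLast?_reverse, List.head?_drop, hw] at hc
        simpa [eq_comm] using hc
      have h2 : d = x := by
        rw [List.head?_append, List.head?_take, if_neg (by omega), hx] at hd'
        simpa [eq_comm] using hd'
      subst h1 h2
      exact (hS _ hwS).2.symm
  · have hsub : (R.take (p + 1) ++ R.drop q).Sublist R := by
      conv_rhs => rw [← List.take_append_drop (p + 1) R]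
      refine List.Sublist.append (List.Sublist.refl _) ?_
      have : R.drop q = (R.drop (p + 1)).drop (q - (p + 1)) := by
        rw [List.drop_drop]
        congr 1
        omega
      rw [this]
      exact List.drop_sublist _ _
    exact ((List.reverse_perm (R.drop q)).append_left (R.take (p + 1))).nodup_iff.2
      (hnd.sublist hsub)
  · rw [hlen]
    rcases Nat.lt_or_ge (p + 1) q with h | h
    · right
      have hdisj : Disjoint ((positions R S).erase q)
          ((positions R T).map ⟨(· + 1), add_left_injective 1⟩) := by
        rw [Finset.disjoint_left]
        intro j hj hj'
        obtain ⟨i, hi, rfl⟩ := Finset.mem_map.1 hj'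
        have := hmin i hi (i + 1) (Finset.mem_of_mem_erase hj) (Nat.lt_succ_self i)
        omega
      have hsub : (positions R S).erase q ∪
          (positions R T).map ⟨(· + 1), add_left_injective 1⟩ ⊆
          Finset.Icc 1 (p + 1) ∪ Finset.Ico (q + 1) R.length := by
        intro j hj
        rw [Finset.mem_union, Finset.mem_Icc, Finset.mem_Ico]
        rcases Finset.mem_union.1 hj with hj | hj
        · obtain ⟨hjq, hj⟩ := Finset.mem_erase.1 hj
          obtain ⟨z, hz, hjz⟩ := mem_positions.1 hj
          have h1 := (List.getElem?_eq_some_iff.1 hjz).1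
          have h0 : j ≠ 0 := by
            rintro rfl
            rw [← List.head?_eq_getElem?, hx, Option.some_inj] at hjz
            exact (hS z hz).2.ne hjz
          by_contra hcon
          have := hmin p hp j hj (by omega)
          omega
        · obtain ⟨i, hi, rfl⟩ := Finset.mem_map.1 hj
          obtain ⟨z, hz, hiz⟩ := mem_positions.1 hi
          have h1 := (List.getElem?_eq_some_iff.1 hiz).1
          have h0 : i ≠ R.length - 1 := by
            rintro rfl
            rw [← List.getLast?_eq_getElem?, hy, Option.some_inj] at hiz
            exact (hT z hz).2.ne hiz
          by_contra hcon
          simp only [Function.Embedding.coeFn_mk] at hcon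
          have := hmin i hi q hq (by omega)
          omega
      have h1 := Finset.card_le_card hsub
      rw [Finset.card_union_of_disjoint hdisj, Finset.card_map, Finset.card_erase_of_mem hq] at h1
      have h2 := Finset.card_union_le (Finset.Icc 1 (p + 1)) (Finset.Ico (q + 1) R.length)
      have h3 := card_le_card_positions fun z hz => (hS z hz).1
      have h4 := card_le_card_positions fun z hz => (hT z hz).1
      have h5 := Finset.card_pos.2 ⟨q, hq⟩
      simp only [Nat.card_Icc, Nat.card_Ico] at h2
      omega
    · left
      omega

lemma exists_cyclicChain_of_head_adj {x : V} (L : List V) (hch : L.IsChain G.Adj) (hnd : L.Nodup)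
    (hx : L.head? = some x) (S : Finset V) (hS : ∀ z ∈ S, z ∈ L ∧ G.Adj x z) :
    ∃ C : List V, C <+: L ∧ CyclicChain G C ∧ S.card + 1 ≤ C.length := by
  classical
  induction L using List.reverseRecOn with
  | nil => simp at hx
  | append_singleton L z ih =>
    by_cases hz : L = [] ∨ G.Adj x z
    · refine ⟨L ++ [z], List.prefix_rfl, ?_, ?_⟩
      · rcases hz with rfl | hz
        · exact cyclicChain_singleton z
        · apply cyclicChain_of_isChain hch
          intro a ha b hb
          rw [hx] at hb
          simp only [List.getLast?_append, List.getLast?_singleton, Option.some_or,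
            Option.mem_def, Option.some_inj] at ha hb
          subst ha hb
          exact hz.symm
      · have hxL : x ∈ L ++ [z] := List.mem_of_mem_head? hx
        have hxS : x ∉ S := fun h => (hS x h).2.ne rfl
        have hsub : insert x S ⊆ (L ++ [z]).toFinset := by
          intro w hw
          rw [List.mem_toFinset]
          rcases Finset.mem_insert.1 hw with rfl | hw
          · exact hxL
          · exact (hS w hw).1
        have := Finset.card_le_card hsub
        rwa [Finset.card_insert_of_notMem hxS, List.toFinset_card_of_nodup hnd] at this
    · push Not at hz
      obtain ⟨C, hC, h⟩ := ih hch.left_of_append (hnd.sublist (List.sublist_append_left _ _))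
        (by rwa [List.head?_append_of_ne_nil _ hz.1] at hx) (by
          intro w hw
          refine ⟨?_, (hS w hw).2⟩
          rcases List.mem_append.1 (hS w hw).1 with h | h
          · exact h
          · rw [List.mem_singleton] at h
            subst h
            exact absurd (hS w hw).2 hz.2)
      exact ⟨C, hC.trans (List.prefix_append _ _), h⟩

/-- In an edge-maximal graph without long paths, non-adjacent vertices are ends of two disjoint
paths covering many vertices. -/
lemma exists_two_paths {k : ℕ} (hmax : Maximal (fun H : SimpleGraph V => PathBound H k) G)
    {x y : V} (hne : x ≠ y) (hxy : ¬ G.Adj x y) :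
    ∃ A B : List V, A.IsChain G.Adj ∧ B.IsChain G.Adj ∧ (A ++ B).Nodup ∧
      A.head? = some x ∧ B.getLast? = some y ∧ k + 1 ≤ A.length + B.length := by
  classical
  have hnot : ¬ PathBound (G ⊔ SimpleGraph.edge x y) k := by
    intro h
    apply hxy
    refine hmax.2 h le_sup_left ?_
    simp [SimpleGraph.edge_adj, hne]
  simp only [PathBound, not_forall, not_le] at hnot
  obtain ⟨l, hch, hnd, hlen⟩ := hnot
  have hsmall : ∀ l' : List V, l'.IsChain (G ⊔ SimpleGraph.edge x y).Adj →
      ¬ (x ∈ l' ∧ y ∈ l') → l'.IsChain G.Adj := by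
    intro l' h hn
    refine List.IsChain.imp_of_mem_imp ?_ h
    intro a b ha hb hab
    rcases hab with hab | hab
    · exact hab
    · rw [SimpleGraph.edge_adj] at hab
      rcases hab.1 with ⟨rfl, rfl⟩ | ⟨rfl, rfl⟩
      · exact absurd ⟨ha, hb⟩ hn
      · exact absurd ⟨hb, ha⟩ hn
  have hnch : ¬ l.IsChain G.Adj := fun h => by
    have := hmax.1 l h hnd
    omega
  rw [List.isChain_iff_forall_rel_of_append_cons_cons] at hnch
  push Not at hnch
  obtain ⟨a, b, s, t, rfl, hab⟩ := hnch
  have hl : s ++ a :: b :: t = (s ++ [a]) ++ (b :: t) := by simp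
  rw [hl] at hch hnd hlen
  have hab' : (G ⊔ SimpleGraph.edge x y).Adj a b := by
    rw [List.append_assoc, List.singleton_append] at hch
    exact (List.isChain_append_cons_cons.1 hch).2.1
  have hdis := (List.nodup_append.1 hnd).2.2
  have hbs : b ∉ s ++ [a] := fun h => hdis b h b (by simp) rfl
  have hat : a ∉ b :: t := fun h => hdis a (by simp) a h rfl
  rw [List.length_append] at hlen
  rcases hab' with h | h
  · exact absurd h hab
  · rw [SimpleGraph.edge_adj] at h
    rcases h.1 with ⟨rfl, rfl⟩ | ⟨rfl, rfl⟩
    · refine ⟨(s ++ [a]).reverse, (b :: t).reverse,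
        isChain_reverse_adj (hsmall _ hch.left_of_append fun h => hbs h.2),
        isChain_reverse_adj (hsmall _ hch.right_of_append fun h => hat h.1), ?_, by simp,
        by simp, by simp only [List.length_reverse]; omega⟩
      exact ((List.reverse_perm _).append (List.reverse_perm _)).nodup_iff.2 hnd
    · refine ⟨b :: t, s ++ [a],
        hsmall _ hch.right_of_append fun h => hat h.2,
        hsmall _ hch.left_of_append fun h => hbs h.1, ?_, by simp, by simp, by omega⟩
      exact List.perm_append_comm.nodup_iff.2 hnd

/-- Kopylov's argument: in a connected edge-maximal graph without paths on more than `k` vertices,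
two vertex sets inducing minimum degrees at least `a` and `b`, with `a + b ≥ k`, are completely
joined. -/
lemma adj_of_le_degree [DecidableRel G.Adj] {k : ℕ}
    (hmax : Maximal (fun H : SimpleGraph V => PathBound H k) G) (hG : G.Connected)
    {U W : Finset V} {a b : ℕ} (hU : ∀ u ∈ U, a ≤ {z ∈ U | G.Adj u z}.card)
    (hW : ∀ w ∈ W, b ≤ {z ∈ W | G.Adj w z}.card) (hab : k ≤ a + b) {x y : V} (hx : x ∈ U)
    (hy : y ∈ W) (hne : x ≠ y) : G.Adj x y := by
  classical
  have hk : PathBound G k := hmax.1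
  have key : ∀ (N : ℕ) (x y : V) (A B : List V), x ∈ U → y ∈ W → ¬ G.Adj x y →
      A.IsChain G.Adj → B.IsChain G.Adj → (A ++ B).Nodup → A.head? = some x →
      B.getLast? = some y → k + 1 ≤ A.length + B.length →
      2 * k + 1 ≤ A.length + B.length + N → False := by
    intro N
    induction N with
    | zero =>
      intro x y A B _ _ _ hA hB hnd _ _ _ hN
      have h1 := hk A hA (List.nodup_append.1 hnd).1
      have h2 := hk B hB (List.nodup_append.1 hnd).2.1
      omega
    | succ N ih =>
      intro x y A B hx hy hxy hA hB hnd hAx hBy hlen hN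
      have hcommon : ∀ z, z ∉ A ++ B → G.Adj x z → G.Adj y z → False := by
        intro z hz hxz hyz
        have hch : (A.reverse ++ z :: B.reverse).IsChain G.Adj := by
          refine List.IsChain.append (isChain_reverse_adj hA) ?_ ?_
          · refine List.IsChain.cons (isChain_reverse_adj hB) ?_
            intro w hw
            rw [List.head?_reverse, hBy, Option.mem_some_iff] at hw
            subst hw
            exact hyz.symm
          · intro c hc d hd
            rw [List.getLast?_reverse, hAx, Option.mem_some_iff] at hc
            rw [List.head?_cons, Option.mem_some_iff] at hd
            subst hc hd
            exact hxz
        have hperm : (A.reverse ++ z :: B.reverse).Perm (z :: (A ++ B)) :=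
          List.perm_middle.trans
            (List.Perm.cons _ ((List.reverse_perm _).append (List.reverse_perm _)))
        have := hk _ hch (hperm.nodup_iff.2 (List.nodup_cons.2 ⟨hz, hnd⟩))
        rw [hperm.length_eq] at this
        simp at this
        omega
      set S : Finset V := {z ∈ U | G.Adj x z} with hSdef
      set T : Finset V := {z ∈ W | G.Adj y z} with hTdef
      have hS : ∀ z ∈ S, z ∈ A ++ B ∧ G.Adj x z := by
        intro z hz
        obtain ⟨hzU, hxz⟩ := Finset.mem_filter.1 hz
        refine ⟨?_, hxz⟩
        by_contra hzR
        by_cases hyz : G.Adj y z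
        · exact hcommon z hzR hxz hyz
        · refine ih z y (z :: A) B hzU hy (fun h => hyz h.symm) ?_ hB ?_ rfl hBy
            (by simp; omega) (by simp; omega)
          · refine List.IsChain.cons hA ?_
            intro w hw
            rw [hAx, Option.mem_some_iff] at hw
            subst hw
            exact hxz.symm
          · exact List.nodup_cons.2 ⟨hzR, hnd⟩
      have hT : ∀ z ∈ T, z ∈ A ++ B ∧ G.Adj y z := by
        intro z hz
        obtain ⟨hzW, hyz⟩ := Finset.mem_filter.1 hz
        refine ⟨?_, hyz⟩
        by_contra hzR
        by_cases hxz : G.Adj x z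
        · exact hcommon z hzR hxz hyz
        · refine ih x z A (B ++ [z]) hx hzW hxz hA ?_ ?_ hAx (by simp) (by simp; omega)
            (by simp; omega)
          · refine List.IsChain.append hB (List.isChain_singleton z) ?_
            intro c hc d hd
            rw [hBy, Option.mem_some_iff] at hc
            rw [List.head?_cons, Option.mem_some_iff] at hd
            subst hc hd
            exact hyz
          · rw [← List.append_assoc]
            exact (List.perm_append_singleton z (A ++ B)).nodup_iff.2
              (List.nodup_cons.2 ⟨hzR, hnd⟩)
      have hScard : a ≤ S.card := hU x hx
      have hTcard : b ≤ T.card := hW y hy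
      by_cases hsep : (∀ z ∈ S, z ∈ A) ∧ ∀ z ∈ T, z ∈ B
      · obtain ⟨C, hCA, hC, hClen⟩ := exists_cyclicChain_of_head_adj A hA (List.nodup_append.1 hnd).1
          hAx S fun z hz => ⟨hsep.1 z hz, (hS z hz).2⟩
        obtain ⟨D, hDB, hD, hDlen⟩ := exists_cyclicChain_of_head_adj B.reverse (isChain_reverse_adj hB)
          (List.nodup_reverse.2 (List.nodup_append.1 hnd).2.1)
          (by rw [List.head?_reverse, hBy]) T
          fun z hz => ⟨List.mem_reverse.2 (hsep.2 z hz), (hT z hz).2⟩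
        have hnd' : (C ++ D).Nodup := by
          have h1 : (A ++ B.reverse).Nodup :=
            ((List.reverse_perm B).append_left A).nodup_iff.2 hnd
          exact h1.sublist (hCA.sublist.append hDB.sublist)
        have := hk.length_add_length_le hG hC hD hnd' (by rintro rfl; simp at hClen)
          (by rintro rfl; simp at hDlen)
        omega
      · set R : List (Option V) := A.map some ++ none :: B.map some with hR
        have hmem : ∀ z, z ∈ A ++ B → some z ∈ R := by
          intro z hz
          simpa [hR] using hz
        have hRnd : R.Nodup := by
          have hperm : R.Perm (none :: (A ++ B).map some) := by
            rw [List.map_append]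
            exact List.perm_middle
          rw [hperm.nodup_iff, List.nodup_cons]
          exact ⟨by simp, hnd.map (Option.some_injective _)⟩
        have hRch : R.IsChain (coneGraph G).Adj := by
          refine List.IsChain.append (isChain_map_some.2 hA)
            (List.IsChain.cons (isChain_map_some.2 hB) ?_) ?_
          · intro z hz
            rw [List.head?_map] at hz
            obtain ⟨w, -, rfl⟩ := Option.map_eq_some_iff.1 hz
            exact coneGraph_none_some
          · intro z hz w hw
            rw [List.getLast?_map] at hz
            obtain ⟨v, -, rfl⟩ := Option.map_eq_some_iff.1 hz
            rw [List.head?_cons, Option.mem_some_iff] at hw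
            subst hw
            exact coneGraph_some_none
        have hRx : R.head? = some (some x) := by
          rw [hR, List.head?_append, List.head?_map, hAx]
          rfl
        have hRy : R.getLast? = some (some y) := by
          rw [hR, List.getLast?_append, List.getLast?_cons, List.getLast?_map, hBy]
          rfl
        have hnone : R[A.length]? = some none := by
          rw [hR, List.getElem?_append_right (by simp)]
          simp
        have hcone : ∀ (v : V) (Q : Finset V), (∀ z ∈ Q, z ∈ A ++ B ∧ G.Adj v z) →
            ∀ z ∈ Finset.insertNone Q, z ∈ R ∧ (coneGraph G).Adj (some v) z := by
          intro v Q hQ z hz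
          rcases z with _ | z
          · exact ⟨by simp [hR], coneGraph_some_none⟩
          · rw [Finset.some_mem_insertNone] at hz
            exact ⟨hmem z (hQ z hz).1, (hQ z hz).2⟩
        have hApos : ∀ Q : Finset V, A.length ∈ positions R (Finset.insertNone Q) := fun Q =>
          mem_positions.2 ⟨none, Finset.none_mem_insertNone, hnone⟩
        obtain ⟨C, hC, hCnd, hClen⟩ := exists_cyclicChain_of_crossing hRch hRnd hRx hRy
          (hcone x S hS) (hcone y T hT) (by
            rw [not_and_or] at hsep
            rcases hsep with h | h
            · push Not at h
              obtain ⟨z, hz, hzA⟩ := h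
              have hzB : z ∈ B := (List.mem_append.1 (hS z hz).1).resolve_left hzA
              obtain ⟨i, hi⟩ := List.mem_iff_getElem?.1 hzB
              refine ⟨A.length, hApos _, A.length + 1 + i, ?_, by omega⟩
              refine mem_positions.2 ⟨some z, Finset.some_mem_insertNone.2 hz, ?_⟩
              rw [hR, List.getElem?_append_right (by simp; omega), List.length_map,
                show A.length + 1 + i - A.length = i + 1 by omega, List.getElem?_cons_succ,
                List.getElem?_map, hi]
              rfl
            · push Not at h
              obtain ⟨z, hz, hzB⟩ := h
              have hzA : z ∈ A := (List.mem_append.1 (hT z hz).1).resolve_right hzB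
              obtain ⟨i, hi⟩ := List.mem_iff_getElem?.1 hzA
              have hiA := (List.getElem?_eq_some_iff.1 hi).1
              refine ⟨i, ?_, A.length, hApos _, hiA⟩
              refine mem_positions.2 ⟨some z, Finset.some_mem_insertNone.2 hz, ?_⟩
              rw [hR, List.getElem?_append_left (by simpa using hiA), List.getElem?_map, hi]
              rfl)
        have := hk.cyclic_length_le hC hCnd
        rw [Finset.card_insertNone, Finset.card_insertNone] at hClen
        have hRlen : R.length = A.length + B.length + 1 := by
          simp [hR]
          omega
        omega
  by_contra hxy
  obtain ⟨A, B, hA, hB, hnd, hAx, hBy, hlen⟩ := exists_two_paths hmax hne hxy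
  exact key (2 * k + 1) x y A B hx hy hxy hA hB hnd hAx hBy hlen (by omega)

end Crossing

section Binomials

lemma choose_add_choose_le {a b : ℕ} (h : a ≤ b) (e r : ℕ) :
    (a + e).choose (r + 1) + b.choose (r + 1) ≤ (b + e).choose (r + 1) + a.choose (r + 1) := by
  induction e with
  | zero => simp [add_comm]
  | succ e ih =>
    have h1 := Nat.choose_le_choose r (Nat.add_le_add_right h e)
    rw [← add_assoc, ← add_assoc, Nat.choose_succ_succ' (a + e), Nat.choose_succ_succ' (b + e)]
    omega

lemma three_terms_le_choose (m n : ℕ) {s : ℕ} (hs : 2 ≤ s) :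
    n.choose (s + 1) + m * n.choose s + m.choose s * n ≤ (m + n).choose (s + 1) := by
  rw [Nat.add_choose_eq]
  have hsub : ({(0, s + 1), (1, s), (s, 1)} : Finset (ℕ × ℕ)) ⊆
      Finset.HasAntidiagonal.antidiagonal (s + 1) := by
    intro x hx
    simp only [Finset.mem_insert, Finset.mem_singleton] at hx
    rw [Finset.HasAntidiagonal.mem_antidiagonal]
    rcases hx with rfl | rfl | rfl <;> simp [add_comm]
  refine le_trans (le_of_eq ?_) (Finset.sum_le_sum_of_subset hsub)
  rw [Finset.sum_insert, Finset.sum_insert, Finset.sum_singleton]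
  · simp [add_assoc]
  · simp only [Finset.mem_singleton, Prod.mk.injEq]
    omega
  · simp only [Finset.mem_insert, Finset.mem_singleton, Prod.mk.injEq]
    omega

lemma mul_choose_le_choose (j : ℕ) {s : ℕ} (hs : 2 ≤ s) :
    (2 * j + 1) * j.choose s ≤ (2 * j + 1).choose (s + 1) := by
  have h1 := three_terms_le_choose j (j + 1) hs
  have h2 := Nat.mul_le_mul_left j (Nat.choose_le_choose s (Nat.le_succ j))
  rw [show j + (j + 1) = 2 * j + 1 by ring] at h1
  rw [Nat.succ_eq_add_one] at h2
  nlinarith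

lemma choose_add_mul_choose_le {j k i s : ℕ} (hs : 2 ≤ s) (hj : 2 * j ≤ k) (hi : i ≤ 2 * j) :
    (k - j).choose (s + 1) + i * j.choose s ≤ k.choose (s + 1) := by
  obtain ⟨n, rfl⟩ : ∃ n, k = j + n := ⟨k - j, by omega⟩
  have hjn : j ≤ n := by omega
  have h1 := three_terms_le_choose j n hs
  have h2 := Nat.mul_le_mul_left j (Nat.choose_le_choose s hjn)
  have h3 := Nat.mul_le_mul_left (j.choose s) hjn
  have h4 := Nat.mul_le_mul_right (j.choose s) hi
  rw [Nat.add_sub_cancel_left]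
  nlinarith

/-- The number of `r`-cliques in the `n`-vertex disjoint union of copies of `K_k` and one smaller
clique. -/
def cliqueUnionCount (k r n : ℕ) : ℕ := n / k * k.choose r + (n % k).choose r

lemma cliqueUnionCount_mul_add {k r p q : ℕ} (hq : q < k) :
    cliqueUnionCount k r (p * k + q) = p * k.choose r + q.choose r := by
  have hk : 0 < k := by omega
  rw [cliqueUnionCount, add_comm (p * k), Nat.add_mul_div_right _ _ hk,
    Nat.add_mul_mod_self_right, Nat.div_eq_of_lt hq, Nat.mod_eq_of_lt hq, zero_add]

lemma cliqueUnionCount_of_le {k r m : ℕ} (hk : 0 < k) (hm : m ≤ k) :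
    cliqueUnionCount k (r + 1) m = m.choose (r + 1) := by
  rcases hm.lt_or_eq with h | rfl
  · simpa using cliqueUnionCount_mul_add (k := k) (r := r + 1) (p := 0) h
  · simpa using cliqueUnionCount_mul_add (k := m) (r := r + 1) (p := 1) (q := 0) hk

lemma cliqueUnionCount_add_le {k r : ℕ} (hk : 0 < k) (m n : ℕ) :
    cliqueUnionCount k (r + 1) m + cliqueUnionCount k (r + 1) n ≤
      cliqueUnionCount k (r + 1) (m + n) := by
  have ha := Nat.mod_lt m hk
  have hb := Nat.mod_lt n hk
  have hma : m / k * k + m % k = m := Nat.div_add_mod' m k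
  have hnb : n / k * k + n % k = n := Nat.div_add_mod' n k
  generalize m / k = p at hma
  generalize n / k = p' at hnb
  generalize m % k = a at ha hma
  generalize n % k = b at hb hnb
  subst hma hnb
  rw [cliqueUnionCount_mul_add ha, cliqueUnionCount_mul_add hb]
  rcases Nat.lt_or_ge (a + b) k with h | h
  · rw [show p * k + a + (p' * k + b) = (p + p') * k + (a + b) by ring,
      cliqueUnionCount_mul_add h]
    have := choose_add_choose_le (Nat.zero_le b) a r
    rw [Nat.choose_zero_succ, zero_add, add_comm b a] at this
    nlinarith
  · obtain ⟨c, hc⟩ := Nat.exists_eq_add_of_le h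
    rw [show p * k + a + (p' * k + b) = (p + p' + 1) * k + c by linarith,
      cliqueUnionCount_mul_add (by omega)]
    have := choose_add_choose_le (show c ≤ b by omega) (a - c) r
    rw [show c + (a - c) = a by omega, show b + (a - c) = k by omega] at this
    nlinarith

end Binomials

section Counting

variable {V : Type*}

open Classical in
/-- The `r`-cliques of `G` inside `T`. -/
noncomputable def cliquesIn (G : SimpleGraph V) (r : ℕ) (T : Finset V) : Finset (Finset V) :=
  (T.powersetCard r).filter fun s : Finset V => G.IsClique (s : Set V)

/-- The number of `r`-cliques of `G` inside `T`. -/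
noncomputable def cliqueCount (G : SimpleGraph V) (r : ℕ) (T : Finset V) : ℕ :=
  (cliquesIn G r T).card

variable {G : SimpleGraph V}

lemma mem_cliquesIn {r : ℕ} {T s : Finset V} :
    s ∈ cliquesIn G r T ↔ (s ⊆ T ∧ s.card = r) ∧ G.IsClique (s : Set V) := by
  classical
  rw [cliquesIn, Finset.mem_filter, Finset.mem_powersetCard]

lemma cliqueCount_le_choose (r : ℕ) (T : Finset V) : cliqueCount G r T ≤ T.card.choose r := by
  classical
  exact (Finset.card_filter_le _ _).trans (Finset.card_powersetCard r T).le

lemma cliqueCount_mono {H : SimpleGraph V} (h : G ≤ H) (r : ℕ) (T : Finset V) :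
    cliqueCount G r T ≤ cliqueCount H r T := by
  refine Finset.card_le_card fun s hs => ?_
  rw [mem_cliquesIn] at hs ⊢
  exact ⟨hs.1, hs.2.mono h⟩

lemma cliqueCount_le_erase [DecidableEq V] [DecidableRel G.Adj] (r : ℕ) {T : Finset V} (v : V) :
    cliqueCount G (r + 1) T ≤
      cliqueCount G (r + 1) (T.erase v) + {z ∈ T | G.Adj v z}.card.choose r := by
  have hsub : cliquesIn G (r + 1) T ⊆ cliquesIn G (r + 1) (T.erase v) ∪
      (Finset.powersetCard r {z ∈ T | G.Adj v z}).image (insert v) := by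
    intro s hs
    obtain ⟨⟨hsT, hcard⟩, hcl⟩ := mem_cliquesIn.1 hs
    rw [Finset.mem_union]
    by_cases hv : v ∈ s
    · right
      refine Finset.mem_image.2 ⟨s.erase v, Finset.mem_powersetCard.2 ⟨?_, ?_⟩,
        Finset.insert_erase hv⟩
      · intro z hz
        obtain ⟨hzv, hz⟩ := Finset.mem_erase.1 hz
        exact Finset.mem_filter.2 ⟨hsT hz, hcl hv hz hzv.symm⟩
      · rw [Finset.card_erase_of_mem hv, hcard, Nat.add_sub_cancel]
    · left
      exact mem_cliquesIn.2 ⟨⟨Finset.subset_erase.2 ⟨hsT, hv⟩, hcard⟩, hcl⟩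
  refine (Finset.card_le_card hsub).trans ((Finset.card_union_le _ _).trans ?_)
  refine Nat.add_le_add_left (Finset.card_image_le.trans ?_) _
  rw [Finset.card_powersetCard]

lemma cliqueCount_le_add_compl [Fintype V] [DecidableEq V] (r : ℕ) (T : Finset V)
    (hT : ∀ u ∈ T, ∀ v ∉ T, ¬ G.Adj u v) :
    cliqueCount G (r + 1) Finset.univ ≤ cliqueCount G (r + 1) T + cliqueCount G (r + 1) Tᶜ := by
  refine le_trans (Finset.card_le_card ?_) (Finset.card_union_le _ _)
  intro s hs
  obtain ⟨⟨-, hcard⟩, hcl⟩ := mem_cliquesIn.1 hs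
  rw [Finset.mem_union, mem_cliquesIn, mem_cliquesIn]
  obtain ⟨a, ha⟩ := Finset.card_pos.1 (by omega : 0 < s.card)
  by_cases haT : a ∈ T
  · refine Or.inl ⟨⟨fun b hb => ?_, hcard⟩, hcl⟩
    by_contra hbT
    exact hT a haT b hbT (hcl ha hb (by rintro rfl; exact hbT haT))
  · refine Or.inr ⟨⟨fun b hb => ?_, hcard⟩, hcl⟩
    rw [Finset.mem_compl]
    intro hbT
    exact hT b hbT a haT (hcl hb ha (by rintro rfl; exact haT hbT))

lemma cliqueCount_le_induce (r : ℕ) (T : Finset V) :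
    cliqueCount G r T ≤ cliqueCount (G.induce {v | v ∈ T}) r
      (Finset.univ : Finset {v // v ∈ T}) := by
  classical
  refine Finset.card_le_card_of_surjOn
    (fun s : Finset {v // v ∈ T} => s.map (Function.Embedding.subtype _)) ?_
  intro s hs
  obtain ⟨⟨hsT, hcard⟩, hcl⟩ := mem_cliquesIn.1 (Finset.mem_coe.1 hs)
  have hmap : (s.subtype (· ∈ T)).map (Function.Embedding.subtype _) = s :=
    Finset.subtype_map_of_mem fun x hx => hsT hx
  refine ⟨s.subtype (· ∈ T), Finset.mem_coe.2 (mem_cliquesIn.2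
    ⟨⟨Finset.subset_univ _, ?_⟩, ?_⟩), hmap⟩
  · rw [← hcard, ← congrArg Finset.card hmap, Finset.card_map]
  · intro a ha b hb hab
    exact hcl (Finset.mem_subtype.1 ha) (Finset.mem_subtype.1 hb)
      (fun h => hab (Subtype.ext h))

lemma PathBound.induce {k : ℕ} (hk : PathBound G k) (S : Set V) : PathBound (G.induce S) k := by
  intro l hl hnd
  rw [← List.length_map (f := Subtype.val)]
  exact hk _ ((List.isChain_map _).2 hl) (hnd.map Subtype.val_injective)

variable [DecidableRel G.Adj]

/-- `K` is the `d`-core of `G`, the largest vertex set inducing minimum degree at least `d`. -/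
def IsCore (G : SimpleGraph V) [DecidableRel G.Adj] (d : ℕ) (K : Finset V) : Prop :=
  (∀ u ∈ K, d ≤ {z ∈ K | G.Adj u z}.card) ∧
    ∀ T : Finset V, (∀ u ∈ T, d ≤ {z ∈ T | G.Adj u z}.card) → T ⊆ K

lemma exists_isCore [Fintype V] (d : ℕ) : ∃ K : Finset V, IsCore G d K := by
  classical
  let F : Finset (Finset V) := {T | ∀ u ∈ T, d ≤ {z ∈ T | G.Adj u z}.card}
  have hle : ∀ T ∈ F, T ⊆ F.biUnion id := fun T hT => Finset.subset_biUnion_of_mem id hT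
  refine ⟨F.biUnion id, ?_, fun T hT => hle T (by simpa [F] using hT)⟩
  intro u hu
  obtain ⟨T, hT, huT⟩ := Finset.mem_biUnion.1 hu
  have h1 : d ≤ {z ∈ T | G.Adj u z}.card := (Finset.mem_filter.1 hT).2 u huT
  exact h1.trans (Finset.card_le_card (Finset.filter_subset_filter _ (hle T hT)))

lemma IsCore.exists_cliqueCount_le [Fintype V] {j : ℕ} {K : Finset V} (hK : IsCore G (j + 1) K)
    (r : ℕ) (i : ℕ) (hi : K.card + i ≤ Fintype.card V) :
    ∃ T : Finset V, K ⊆ T ∧ T.card + i = Fintype.card V ∧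
      cliqueCount G (r + 1) Finset.univ ≤ cliqueCount G (r + 1) T + i * j.choose r := by
  classical
  induction i with
  | zero => exact ⟨Finset.univ, Finset.subset_univ _, by simp, by simp⟩
  | succ i ih =>
    obtain ⟨T, hKT, hT, hle⟩ := ih (by omega)
    have hex : ∃ v ∈ T, v ∉ K ∧ {z ∈ T | G.Adj v z}.card ≤ j := by
      by_contra hcon
      push Not at hcon
      have hTK : T ⊆ K := by
        refine hK.2 T fun u hu => ?_
        by_cases huK : u ∈ K
        · exact (hK.1 u huK).trans (Finset.card_le_card (Finset.filter_subset_filter _ hKT))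
        · exact hcon u hu huK
      have := Finset.card_le_card hTK
      omega
    obtain ⟨v, hvT, hvK, hv⟩ := hex
    have hcard := Finset.card_erase_of_mem hvT
    have hpos := Finset.card_pos.2 ⟨v, hvT⟩
    refine ⟨T.erase v, Finset.subset_erase.2 ⟨hKT, hvK⟩, by omega, ?_⟩
    have h1 := cliqueCount_le_erase (G := G) r (T := T) v
    have h2 := Nat.choose_le_choose r hv
    rw [Nat.succ_mul]
    omega

lemma exists_isCore_card_add_le [Fintype V] {k : ℕ} (hk : 0 < k)
    (hmax : Maximal (fun H : SimpleGraph V => PathBound H k) G) (hG : G.Connected) :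
    ∃ (j : ℕ) (K : Finset V), 2 * j + 1 ≤ k ∧ IsCore G (j + 1) K ∧ K.card + j ≤ k := by
  classical
  obtain ⟨d, hd1, hd2⟩ : ∃ d, 2 * d + 1 ≤ k ∧ k ≤ 2 * d + 2 := ⟨(k - 1) / 2, by omega, by omega⟩
  obtain ⟨U, hU⟩ := exists_isCore (G := G) (d + 1)
  rcases U.eq_empty_or_nonempty with rfl | ⟨u, hu⟩
  · exact ⟨d, ∅, hd1, hU, by simp; omega⟩
  have hcl : ∀ x ∈ U, ∀ y ∈ U, x ≠ y → G.Adj x y := fun x hx y hy hne =>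
    adj_of_le_degree hmax hG hU.1 hU.1 (by omega) hx hy hne
  have hdeg : ∀ x ∈ U, ({z ∈ U | G.Adj x z} : Finset V) = U.erase x := by
    intro x hx
    ext z
    rw [Finset.mem_filter, Finset.mem_erase]
    exact ⟨fun h => ⟨h.2.ne', h.1⟩, fun h => ⟨h.2, hcl x hx z h.2 h.1.symm⟩⟩
  have hs1 : d + 2 ≤ U.card := by
    have h1 := hU.1 u hu
    rw [hdeg u hu, Finset.card_erase_of_mem hu] at h1
    omega
  have hs2 : U.card ≤ k := by
    have h1 : U.toList.IsChain G.Adj := by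
      refine List.Pairwise.isChain ?_
      refine List.Pairwise.imp_of_mem ?_ U.nodup_toList
      intro a b ha hb hab
      exact hcl a (Finset.mem_toList.1 ha) b (Finset.mem_toList.1 hb) hab
    simpa using hmax.1 _ h1 U.nodup_toList
  obtain ⟨W, hW⟩ := exists_isCore (G := G) (k - U.card + 1)
  have hWU : W ⊆ U := by
    intro x hxW
    by_contra hxU
    have hadj : ∀ y ∈ U, G.Adj x y := by
      intro y hy
      refine adj_of_le_degree (b := U.card - 1) hmax hG hW.1 ?_ (by omega) hxW hy ?_
      · intro w hw
        rw [hdeg w hw, Finset.card_erase_of_mem hw]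
      · rintro rfl
        exact hxU hy
    refine hxU (hU.2 (insert x U) ?_ (Finset.mem_insert_self x U))
    intro w hw
    rcases Finset.mem_insert.1 hw with rfl | hw
    · have hsub : U ⊆ {z ∈ insert w U | G.Adj w z} := fun z hz =>
        Finset.mem_filter.2 ⟨Finset.mem_insert_of_mem hz, hadj z hz⟩
      have := Finset.card_le_card hsub
      omega
    · exact (hU.1 w hw).trans
        (Finset.card_le_card (Finset.filter_subset_filter _ (Finset.subset_insert x U)))
  have := Finset.card_le_card hWU
  exact ⟨k - U.card, W, by omega, hW, by omega⟩

end Counting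

lemma cliqueCount_le_cliqueUnionCount {k s : ℕ} (hk : 0 < k) (hs : 2 ≤ s) (n : ℕ) :
    ∀ (V : Type) [Fintype V] (G : SimpleGraph V), Fintype.card V = n → PathBound G k →
      cliqueCount G (s + 1) Finset.univ ≤ cliqueUnionCount k (s + 1) n := by
  classical
  induction n using Nat.strong_induction_on with
  | _ n ih =>
  intro V _ G₀ hn hG₀
  obtain ⟨G, hle, hmax⟩ :=
    (Set.toFinite {H : SimpleGraph V | PathBound H k}).exists_le_maximal hG₀
  replace hmax : Maximal (fun H : SimpleGraph V => PathBound H k) G := hmax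
  refine (cliqueCount_mono hle _ _).trans ?_
  have hsub : ∀ T : Finset V, T.card < n →
      cliqueCount G (s + 1) T ≤ cliqueUnionCount k (s + 1) T.card := fun T hT =>
    (cliqueCount_le_induce _ T).trans
      (ih _ hT {v // v ∈ T} (G.induce {v | v ∈ T}) (by simp) (hmax.1.induce _))
  rcases Nat.lt_or_ge k n with hkn | hkn
  swap
  · rw [cliqueUnionCount_of_le hk hkn, ← hn]
    exact cliqueCount_le_choose _ _
  by_cases hconn : G.Connected
  · obtain ⟨j, K, hj, hK, hKj⟩ := exists_isCore_card_add_le hk hmax hconn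
    rcases Nat.lt_or_ge (k + j) n with hnj | hnj
    · obtain ⟨T, -, hT, hTle⟩ := hK.exists_cliqueCount_le s (2 * j + 1) (by omega)
      have h1 := hsub T (by omega)
      have h2 := mul_choose_le_choose j hs
      have h3 := cliqueUnionCount_add_le (r := s) hk T.card (2 * j + 1)
      rw [cliqueUnionCount_of_le hk hj, hT, hn] at h3
      omega
    · obtain ⟨T, -, hT, hTle⟩ := hK.exists_cliqueCount_le s (n - k + j) (by omega)
      have h1 := cliqueCount_le_choose (G := G) (s + 1) T
      rw [show T.card = k - j by omega] at h1
      have h2 := choose_add_mul_choose_le (k := k) (j := j) (i := n - k + j) hs (by omega)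
        (by omega)
      have h3 := cliqueUnionCount_add_le (r := s) hk k (n - k)
      rw [cliqueUnionCount_of_le hk le_rfl, show k + (n - k) = n by omega] at h3
      omega
  · have hne : Nonempty V := Fintype.card_pos_iff.1 (by omega)
    rw [SimpleGraph.connected_iff, not_and_or] at hconn
    have hpre : ¬ G.Preconnected := hconn.resolve_right (not_not.2 hne)
    simp only [SimpleGraph.Preconnected, not_forall] at hpre
    obtain ⟨a, b, hab⟩ := hpre
    let T : Finset V := {v | G.Reachable a v}
    have haT : a ∈ T := by simp [T]
    have hbT : b ∉ T := by simpa [T] using hab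
    have hadd := cliqueCount_le_add_compl (G := G) s T (by
      intro u hu v hv huv
      simp only [T, Finset.mem_filter, Finset.mem_univ, true_and] at hu hv
      exact hv (hu.trans huv.reachable))
    have hcard := Finset.card_add_card_compl T
    have h1 := Finset.card_pos.2 ⟨a, haT⟩
    have h2 := Finset.card_pos.2 ⟨b, Finset.mem_compl.2 hbT⟩
    have h3 := hsub T (by omega)
    have h4 := hsub Tᶜ (by omega)
    have h5 := cliqueUnionCount_add_le (r := s) hk T.card Tᶜ.card
    rw [hcard, hn] at h5
    omega


/-- Chakraborti–Chen: if `G` is an `n`-vertex graph with no path of `k` edges,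
`3 ≤ r ≤ k` and `n = p·k + q` with `0 ≤ q ≤ k−1`, then the number of `r`-cliques
of `G` is at most `p·C(k,r) + C(q,r)` (the number of `r`-cliques of `p·K_k ∪ K_q`). -/
theorem clique_count_path_free (n r k p q : ℕ) (hn : 1 ≤ n) (hr : 3 ≤ r) (hrk : r ≤ k)
    (hnpq : n = p * k + q) (hq : q ≤ k - 1)
    (G : SimpleGraph (Fin n)) [DecidableRel G.Adj]
    (hGfree : ¬ ∃ (u v : Fin n) (w : G.Walk u v), w.IsPath ∧ w.length = k) :
    (G.cliqueFinset r).card ≤ p * Nat.choose k r + Nat.choose q r := by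
  classical
  have hk : PathBound G k := by
    intro l hl hnd
    by_contra hlen
    have hlt : (l.take (k + 1)).length = k + 1 := by
      rw [List.length_take]
      omega
    have hne : l.take (k + 1) ≠ [] := by
      intro h
      rw [h] at hlt
      simp at hlt
    refine hGfree ⟨_, _, SimpleGraph.Walk.ofSupport (l.take (k + 1)) hne (hl.take _), ?_, ?_⟩
    · rw [SimpleGraph.Walk.isPath_def, SimpleGraph.Walk.support_ofSupport]
      exact hnd.sublist (List.take_sublist _ _)
    · rw [SimpleGraph.Walk.length_ofSupport, hlt, Nat.add_sub_cancel]
  obtain ⟨s, rfl⟩ : ∃ s, r = s + 1 := ⟨r - 1, by omega⟩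
  have hmain := cliqueCount_le_cliqueUnionCount (s := s) (by omega) (by omega) n (Fin n) G
    (Fintype.card_fin n) hk
  have hcount := cliqueUnionCount_mul_add (k := k) (r := s + 1) (p := p) (q := q) (by omega)
  rw [← hnpq] at hcount
  rw [hcount] at hmain
  refine le_trans (Finset.card_le_card ?_) hmain
  intro t ht
  rw [SimpleGraph.mem_cliqueFinset_iff, SimpleGraph.isNClique_iff] at ht
  exact mem_cliquesIn.2 ⟨⟨Finset.subset_univ _, ht.2⟩, ht.1⟩
end

section
/- Let r ≥ 2, k ≥ r+1, and n = pk + q with 0 ≤ q < k. Partition an n-vertex set into p sets of size k and one set of size q, and let H be the r-uniform hypergraph whose hyperedges are all r-element subsets contained in one of the parts. Then H has exactly p·C(k,r) + C(q,r) hyperedges and contains no Berge path of length k. -/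
/-- A Berge path of length `k` in a hypergraph with hyperedge set `E`. -/
def IsBergePath {V : Type*} (E : Finset (Finset V)) (k : ℕ)
    (v : Fin (k + 1) → V) (h : Fin k → Finset V) : Prop :=
  Function.Injective v ∧ Function.Injective h ∧ (∀ i, h i ∈ E) ∧
    ∀ i : Fin k, v i.castSucc ∈ h i ∧ v i.succ ∈ h i

def HasBergePath {V : Type*} (E : Finset (Finset V)) (k : ℕ) : Prop :=
  ∃ v h, IsBergePath E k v h

/-- If every hyperedge lies inside one part of a disjoint family, then so do the vertices of a
Berge path. -/
theorem IsBergePath.exists_forall_mem {V ι : Type*} {E : Finset (Finset V)} {P : ι → Finset V}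
    (hdisj : ∀ i j, i ≠ j → Disjoint (P i) (P j)) (hE : ∀ S ∈ E, ∃ i, S ⊆ P i) {k : ℕ}
    (hk : 0 < k) {v : Fin (k + 1) → V} {h : Fin k → Finset V} (hp : IsBergePath E k v h) :
    ∃ i, ∀ m, v m ∈ P i := by
  obtain ⟨-, -, hmem, hinc⟩ := hp
  obtain ⟨i, hi⟩ := hE _ (hmem ⟨0, hk⟩)
  refine ⟨i, fun m => ?_⟩
  induction m using Fin.induction with
  | zero => exact hi (hinc ⟨0, hk⟩).1
  | succ m ih =>
    obtain ⟨j, hj⟩ := hE _ (hmem m)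
    have hij : i = j := by
      by_contra hne
      exact Finset.disjoint_left.mp (hdisj i j hne) ih (hj (hinc m).1)
    exact hij ▸ hj (hinc m).2

theorem not_hasBergePath_of_card_le {V ι : Type*} {E : Finset (Finset V)} {P : ι → Finset V}
    (hdisj : ∀ i j, i ≠ j → Disjoint (P i) (P j)) (hE : ∀ S ∈ E, ∃ i, S ⊆ P i) {k : ℕ}
    (hk : 0 < k) (hcard : ∀ i, (P i).card ≤ k) : ¬ HasBergePath E k := by
  rintro ⟨v, h, hp⟩
  obtain ⟨i, hi⟩ := hp.exists_forall_mem hdisj hE hk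
  have hle := Finset.card_le_card_of_injOn (s := Finset.univ) v (fun m _ => hi m) hp.1.injOn
  rw [Finset.card_univ, Fintype.card_fin] at hle
  exact absurd (hle.trans (hcard i)) (by omega)

/-- The number of `r`-sets lying inside a part of a disjoint family, for `r` positive. -/
theorem card_filter_card_eq_and_subset {V ι : Type*} [Fintype V] [DecidableEq V] [Fintype ι]
    {P : ι → Finset V} (hdisj : ∀ i j, i ≠ j → Disjoint (P i) (P j)) {r : ℕ} (hr : 0 < r)
    [DecidablePred fun S : Finset V => S.card = r ∧ ∃ i, S ⊆ P i] :
    (Finset.univ.filter fun S : Finset V => S.card = r ∧ ∃ i, S ⊆ P i).card =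
      ∑ i, (P i).card.choose r := by
  have hunion : (Finset.univ.filter fun S : Finset V => S.card = r ∧ ∃ i, S ⊆ P i) =
      Finset.univ.biUnion fun i => (P i).powersetCard r := by
    ext S
    simp only [Finset.mem_filter, Finset.mem_univ, true_and, Finset.mem_biUnion,
      Finset.mem_powersetCard]
    tauto
  rw [hunion, Finset.card_biUnion]
  · simp only [Finset.card_powersetCard]
  · intro i _ j _ hij
    refine Finset.disjoint_left.mpr ?_
    intro S hSi hSj
    rw [Finset.mem_powersetCard] at hSi hSj
    obtain ⟨x, hx⟩ := Finset.card_pos.mp (hSi.2.symm ▸ hr)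
    exact Finset.disjoint_left.mp (hdisj i j hij) (hSi.1 hx) (hSj.1 hx)

/-- Lower bound construction: partition an `n`-vertex set (`n = p·k + q`, `q < k`)
into `p` parts of size `k` and one part of size `q`; take as hyperedges all
`r`-element subsets lying inside a part.  The resulting `r`-uniform hypergraph has
`p·C(k,r) + C(q,r)` hyperedges and no Berge path of length `k`. -/
theorem berge_path_lower_construction (r k p q n : ℕ) (hr : 2 ≤ r) (hk : r + 1 ≤ k)
    (hn : n = p * k + q) (hq : q < k)
    (P : Fin (p + 1) → Finset (Fin n))
    (hdisj : ∀ i j, i ≠ j → Disjoint (P i) (P j))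
    (hcover : ∀ x : Fin n, ∃ i, x ∈ P i)
    (hsize : ∀ i : Fin p, (P i.castSucc).card = k)
    (hlast : (P (Fin.last p)).card = q)
    (E : Finset (Finset (Fin n)))
    (hE : E = Finset.univ.filter (fun S : Finset (Fin n) => S.card = r ∧ ∃ i, S ⊆ P i)) :
    E.card = p * Nat.choose k r + Nat.choose q r ∧ ¬ HasBergePath E k := by
  subst hE
  constructor
  · rw [card_filter_card_eq_and_subset hdisj (by omega), Fin.sum_univ_castSucc]
    simp [hsize, hlast]
  · refine not_hasBergePath_of_card_le hdisj (fun S hS => (Finset.mem_filter.mp hS).2.2)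
      (by omega) fun i => ?_
    induction i using Fin.lastCases with
    | last => omega
    | cast i => exact (hsize i).le
end

section
/- For every graph F, every r ≥ 2 and every n, the maximum number of hyperedges in an n-vertex r-uniform hypergraph containing no Berge copy of F is at most ex(n, K_r, F) + ex(n, F), i.e., ex_r(n, Berge-F) ≤ ex(n, K_r, F) + ex(n, F). -/
/-- The hypergraph with hyperedge set `E` contains a Berge copy of the graph `F`. -/
def ContainsBergeCopy {W V : Type*} (F : SimpleGraph W) (E : Finset (Finset V)) : Prop :=
  ∃ (ψ : W → V) (φ : F.edgeSet → Finset V),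
    Function.Injective ψ ∧ Function.Injective φ ∧ (∀ e, φ e ∈ E) ∧
      ∀ (e : F.edgeSet) (w : W), w ∈ (e : Sym2 W) → ψ w ∈ φ e

/-- The graph `G` contains a copy of the graph `F` (a subgraph isomorphic to `F`). -/
def ContainsCopy {W V : Type*} (F : SimpleGraph W) (G : SimpleGraph V) : Prop :=
  ∃ f : W → V, Function.Injective f ∧ ∀ a b, F.Adj a b → G.Adj (f a) (f b)

open Finset in
/-- Splitting one side of a bipartite graph at a set `A` of maximum deficiency: the rest of that side
is saturated by a matching, and so is the neighbourhood of `A`, by a matching into `A`. -/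
theorem Finset.exists_subset_matching_sdiff_and_matching_biUnion {α β : Type*} [DecidableEq α]
    [DecidableEq β] (t : α → Finset β) (E : Finset α) :
    ∃ A ⊆ E,
      (∃ f : ↥(E \ A) → β, Function.Injective f ∧ ∀ a : ↥(E \ A), f a ∈ t a) ∧
      ∃ g : ↥(A.biUnion t) → α, Function.Injective g ∧ ∀ b, g b ∈ A ∧ (b : β) ∈ t (g b) := by
  obtain ⟨A, hA, hmax⟩ := E.powerset.exists_max_image
    (fun A => (#A : ℤ) - #(A.biUnion t)) ⟨∅, empty_mem_powerset E⟩
  simp only [mem_powerset] at hA hmax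
  refine ⟨A, hA, ?_, ?_⟩
  · refine (all_card_le_biUnion_card_iff_exists_injective fun a : ↥(E \ A) => t a).1 fun s => ?_
    set S : Finset α := s.map (Function.Embedding.subtype _) with hS
    have hSE : ∀ a ∈ S, a ∈ E ∧ a ∉ A := by
      simp only [hS, mem_map]
      rintro _ ⟨a, -, rfl⟩
      exact mem_sdiff.1 a.2
    have hdisj : Disjoint A S := disjoint_right.2 fun a ha => (hSE a ha).2
    have hcard : #S = #s := card_map _
    have hbi : S.biUnion t = s.biUnion fun a => t a := by
      ext b
      simp [hS]
    have h := hmax (A ∪ S) (union_subset hA fun a ha => (hSE a ha).1)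
    rw [card_union_of_disjoint hdisj, union_biUnion, hbi] at h
    have h' := card_union_le (A.biUnion t) (s.biUnion fun a => t a)
    omega
  · obtain ⟨g, hg, hgt⟩ := (all_card_le_biUnion_card_iff_exists_injective
      fun b : ↥(A.biUnion t) => A.filter fun a => (b : β) ∈ t a).1 fun s => by
        set S : Finset β := s.map (Function.Embedding.subtype _) with hS
        set R : Finset α := s.biUnion fun b => A.filter fun a => (b : β) ∈ t a with hR
        have hSA : S ⊆ A.biUnion t := by
          intro b hb
          obtain ⟨b, -, rfl⟩ := mem_map.1 hb
          exact b.2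
        have hRA : R ⊆ A := biUnion_subset.2 fun b _ => filter_subset _ _
        have hcard : #S = #s := card_map _
        have hsub : (A \ R).biUnion t ⊆ A.biUnion t \ S := by
          intro b hb
          obtain ⟨a, ha, hab⟩ := mem_biUnion.1 hb
          obtain ⟨haA, haR⟩ := mem_sdiff.1 ha
          refine mem_sdiff.2 ⟨mem_biUnion.2 ⟨a, haA, hab⟩, fun hbS => haR ?_⟩
          obtain ⟨b, hbs, rfl⟩ := mem_map.1 hbS
          exact mem_biUnion.2 ⟨b, hbs, mem_filter.2 ⟨haA, hab⟩⟩
        have h := hmax (A \ R) (sdiff_subset.trans hA)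
        have h1 := card_le_card hsub
        have h2 := card_sdiff_add_card_eq_card hSA
        have h3 := card_sdiff_add_card_eq_card hRA
        omega
    exact ⟨g, hg, fun b => mem_filter.1 (hgt b)⟩

/-- If the edges of `G` extend injectively to hyperedges in `E`, a copy of `F` in `G` yields
a Berge copy of `F` in `E`. -/
theorem ContainsCopy.containsBergeCopy {W V : Type*} {F : SimpleGraph W} {G : SimpleGraph V}
    {E : Finset (Finset V)} (h : ContainsCopy F G) (m : G.edgeSet → Finset V)
    (hm : Function.Injective m) (hmE : ∀ e, m e ∈ E)
    (hmem : ∀ (e : G.edgeSet) (v : V), v ∈ (e : Sym2 V) → v ∈ m e) :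
    ContainsBergeCopy F E := by
  obtain ⟨f, hf, hadj⟩ := h
  let φ : F →g G := ⟨f, fun {a b} => hadj a b⟩
  exact ⟨f, m ∘ φ.mapEdgeSet, hf, hm.comp (SimpleGraph.Hom.mapEdgeSet.injective φ hf),
    fun e => hmE _, fun e w hw => hmem _ _ (Sym2.mem_map.2 ⟨w, hw, rfl⟩)⟩

/-- `ex_r(n, Berge-F) ≤ ex(n, K_r, F) + ex(n, F)`: every `n`-vertex Berge-`F`-free
`r`-uniform hypergraph `E` admits `F`-free `n`-vertex graphs `G₁, G₂` with
`|E| ≤ (#r-cliques of G₁) + (#edges of G₂)`. -/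
theorem berge_turan_le_generalized_turan_add_turan {W : Type*} (F : SimpleGraph W)
    (r n : ℕ) (hr : 2 ≤ r)
    (E : Finset (Finset (Fin n))) (hunif : ∀ e ∈ E, e.card = r)
    (hE : ¬ ContainsBergeCopy F E) :
    ∃ G₁ G₂ : SimpleGraph (Fin n),
      ¬ ContainsCopy F G₁ ∧ ¬ ContainsCopy F G₂ ∧
      E.card ≤ Nat.card {s : Finset (Fin n) // G₁.IsNClique r s} + Nat.card G₂.edgeSet := by
  classical
  let t : Finset (Fin n) → Finset (Sym2 (Fin n)) := fun e => e.sym2.filter fun p => ¬ p.IsDiag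
  have ht {e p} : p ∈ t e ↔ (∀ v ∈ p, v ∈ e) ∧ ¬ p.IsDiag := by
    simp [t, Finset.mem_sym2_iff]
  obtain ⟨A, hA, ⟨f, hf, hft⟩, g, hg, hgt⟩ :=
    Finset.exists_subset_matching_sdiff_and_matching_biUnion t E
  have hedge₁ : (SimpleGraph.fromEdgeSet (A.biUnion t : Set (Sym2 (Fin n)))).edgeSet ⊆
      A.biUnion t := by
    rw [SimpleGraph.edgeSet_fromEdgeSet]
    exact Set.sdiff_subset
  have hedge₂ : (SimpleGraph.fromEdgeSet (Set.range f)).edgeSet = Set.range f := by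
    rw [SimpleGraph.edgeSet_fromEdgeSet, sdiff_eq_left, Set.disjoint_left]
    rintro _ ⟨a, rfl⟩
    exact (ht.1 (hft a)).2
  refine ⟨SimpleGraph.fromEdgeSet (A.biUnion t : Set (Sym2 (Fin n))),
    SimpleGraph.fromEdgeSet (Set.range f), fun h => hE ?_, fun h => hE ?_, ?_⟩
  · exact h.containsBergeCopy (fun e => g ⟨e, hedge₁ e.2⟩)
      (fun e e' hee => Subtype.ext (Subtype.mk.inj (hg hee)))
      (fun e => hA (hgt _).1) fun e => (ht.1 (hgt ⟨e, hedge₁ e.2⟩).2).1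
  · have hsurj (e : (SimpleGraph.fromEdgeSet (Set.range f)).edgeSet) : ∃ a, f a = e :=
      hedge₂.subset e.2
    choose m hm using hsurj
    refine h.containsBergeCopy (fun e => m e) (fun e e' hee => Subtype.ext ?_)
      (fun e => (Finset.mem_sdiff.1 (m e).2).1) fun e => ?_
    · rw [← hm e, ← hm e', Subtype.ext hee]
    · rw [← hm e]
      exact (ht.1 (hft (m e))).1
  · have hclique : A.card ≤ Nat.card {s : Finset (Fin n) //
        (SimpleGraph.fromEdgeSet (A.biUnion t : Set (Sym2 (Fin n)))).IsNClique r s} := by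
      rw [← Fintype.card_coe, ← Nat.card_eq_fintype_card]
      refine Nat.card_le_card_of_injective (fun e : A => ⟨e, ?_, hunif _ (hA e.2)⟩)
        fun e e' hee => Subtype.ext (Subtype.mk.inj hee)
      intro a ha b hb hab
      refine (SimpleGraph.fromEdgeSet_adj _).2 ⟨Finset.mem_biUnion.2 ⟨e, e.2, ht.2 ⟨?_, hab⟩⟩, hab⟩
      simpa [Sym2.mem_iff] using And.intro ha hb
    have hcard₂ : Nat.card (SimpleGraph.fromEdgeSet (Set.range f)).edgeSet = (E \ A).card := by
      rw [hedge₂, Nat.card_range_of_injective hf, Nat.card_eq_fintype_card, Fintype.card_coe]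
    have := Finset.card_sdiff_add_card_eq_card hA
    omega
end

section
/- Let H be an r-uniform hypergraph (r ≥ 3) that contains no Berge path of length r+1 and no Berge cycle of length r+1. Then for every Berge path of length r in H with defining vertices v_1,…,v_{r+1} and defining hyperedges h_1,…,h_r, every hyperedge of H containing an endpoint v_1 or v_{r+1} is one of the defining hyperedges h_1,…,h_r. -/
/-- A Berge cycle of length `k`: `k` distinct vertices and `k` distinct hyperedges,
with `v i, v (i+1) ∈ h i` cyclically. -/
def IsBergeCycle {V : Type*} (E : Finset (Finset V)) (k : ℕ)
    (v : Fin k → V) (h : Fin k → Finset V) : Prop :=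
  Function.Injective v ∧ Function.Injective h ∧ (∀ i, h i ∈ E) ∧
    ∀ i : Fin k, v i ∈ h i ∧ v ⟨((i : ℕ) + 1) % k, Nat.mod_lt _ i.pos⟩ ∈ h i

def HasBergeCycle {V : Type*} (E : Finset (Finset V)) (k : ℕ) : Prop :=
  ∃ v h, IsBergeCycle E k v h

namespace IsBergePath

variable {V : Type*} {E : Finset (Finset V)} {k : ℕ} {v : Fin (k + 1) → V} {h : Fin k → Finset V}

/-- Reversing a Berge path gives a Berge path. -/
theorem reverse (hP : IsBergePath E k v h) : IsBergePath E k (v ∘ Fin.rev) (h ∘ Fin.rev) := by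
  obtain ⟨hv, hh, hE, hm⟩ := hP
  refine ⟨hv.comp Fin.rev_injective, hh.comp Fin.rev_injective, fun i => hE _, fun i => ?_⟩
  have := hm i.rev
  simp only [Function.comp, Fin.rev_castSucc, Fin.rev_succ]
  exact ⟨this.2, this.1⟩

/-- A hyperedge through the first vertex and a vertex off the path prolongs the path. -/
theorem cons (hP : IsBergePath E k v h) {e : Finset V} (he : e ∈ E) (hne : ∀ i, e ≠ h i)
    (h0 : v 0 ∈ e) {x : V} (hx : x ∈ e) (hxv : ∀ i, v i ≠ x) :
    IsBergePath E (k + 1) (Fin.cons x v : Fin (k + 2) → V)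
      (Fin.cons e h : Fin (k + 1) → Finset V) := by
  obtain ⟨hv, hh, hE, hm⟩ := hP
  refine ⟨Fin.cons_injective_iff.2 ⟨?_, hv⟩, Fin.cons_injective_iff.2 ⟨?_, hh⟩, ?_, ?_⟩
  · rintro ⟨i, hi⟩
    exact hxv i hi
  · rintro ⟨i, hi⟩
    exact hne i hi.symm
  · intro i
    cases i using Fin.cases with
    | zero => simpa using he
    | succ i => simpa using hE i
  · intro i
    cases i using Fin.cases with
    | zero => exact ⟨hx, h0⟩
    | succ i =>
      rw [← Fin.succ_castSucc]
      simpa only [Fin.cons_succ] using hm i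

/-- A further hyperedge through both endpoints closes a Berge path into a Berge cycle. -/
theorem isBergeCycle_snoc (hP : IsBergePath E k v h) {e : Finset V} (he : e ∈ E)
    (hne : ∀ i, e ≠ h i) (h0 : v 0 ∈ e) (hl : v (Fin.last k) ∈ e) :
    IsBergeCycle E (k + 1) v (Fin.snoc h e : Fin (k + 1) → Finset V) := by
  obtain ⟨hv, hh, hE, hm⟩ := hP
  refine ⟨hv, Fin.snoc_injective_iff.2 ⟨hh, ?_⟩, ?_, ?_⟩
  · rintro ⟨i, hi⟩
    exact hne i hi.symm
  · intro i
    cases i using Fin.lastCases with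
    | last => simpa using he
    | cast i => simpa using hE i
  · intro i
    cases i using Fin.lastCases with
    | last => simpa using ⟨hl, h0⟩
    | cast i =>
      have hs : (⟨((i.castSucc : Fin (k + 1)) + 1) % (k + 1), Nat.mod_lt _ k.succ_pos⟩ :
          Fin (k + 1)) = i.succ := by
        ext
        simp [Nat.mod_eq_of_lt]
      rw [hs, Fin.snoc_castSucc]
      exact hm i

/-- Replacing the first hyperedge of a Berge path by a further one through the first two
vertices gives a Berge path. -/
theorem update_zero {v : Fin (k + 2) → V} {h : Fin (k + 1) → Finset V}
    (hP : IsBergePath E (k + 1) v h) {e : Finset V} (he : e ∈ E)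
    (hne : ∀ i, e ≠ h i) (h0 : v 0 ∈ e) (h1 : v 1 ∈ e) :
    IsBergePath E (k + 1) v (Function.update h 0 e) := by
  obtain ⟨hv, hh, hE, hm⟩ := hP
  refine ⟨hv, ?_, fun i => ?_, fun i => ?_⟩
  · intro i j hij
    by_cases hi : i = 0 <;> by_cases hj : j = 0 <;> simp_all [hh.eq_iff]
    exact absurd hij.symm (hne i)
  · by_cases hi : i = 0 <;> simp_all
  · by_cases hi : i = 0
    · subst hi
      simpa using ⟨h0, h1⟩
    · simpa [hi] using hm i

/-- If there is no Berge path or Berge cycle of length `k + 1`, a non-defining `k`-element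
hyperedge through the first vertex of a Berge path of length `k` consists of all defining
vertices but the last. -/
theorem eq_map_castSucc (hP : IsBergePath E k v h) (hnp : ¬ HasBergePath E (k + 1))
    (hnc : ¬ HasBergeCycle E (k + 1)) {e : Finset V} (he : e ∈ E) (hcard : e.card = k)
    (hne : ∀ i, e ≠ h i) (h0 : v 0 ∈ e) :
    e = Finset.univ.map (Fin.castSuccEmb.trans ⟨v, hP.1⟩) := by
  refine Finset.eq_of_subset_of_card_le (fun x hx => ?_) (by simp [hcard])
  by_cases hxv : ∀ i, v i ≠ x
  · exact absurd ⟨_, _, hP.cons he hne h0 hx hxv⟩ hnp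
  · push Not at hxv
    obtain ⟨i, rfl⟩ := hxv
    cases i using Fin.lastCases with
    | last => exact absurd ⟨_, _, hP.isBergeCycle_snoc he hne h0 hx⟩ hnc
    | cast i => simp

theorem exists_eq_of_zero_mem (hk : 2 ≤ k) (hunif : ∀ e ∈ E, e.card = k)
    (hP : IsBergePath E k v h) (hnp : ¬ HasBergePath E (k + 1))
    (hnc : ¬ HasBergeCycle E (k + 1)) {e : Finset V} (he : e ∈ E) (h0 : v 0 ∈ e) :
    ∃ i, e = h i := by
  obtain ⟨n, rfl⟩ := Nat.exists_eq_add_of_le' hk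
  by_contra! hne
  have heq := hP.eq_map_castSucc hnp hnc he (hunif e he) hne h0
  have h1 : v 1 ∈ e := by
    rw [heq]
    exact Finset.mem_map.2 ⟨1, Finset.mem_univ _, rfl⟩
  have hP' := hP.update_zero he hne h0 h1
  have hne' : ∀ i, h 0 ≠ Function.update h 0 e i := by
    intro i
    by_cases hi : i = 0
    · subst hi
      simpa using (hne 0).symm
    · simpa [hi] using fun hc => hi (hP.2.1 hc).symm
  have heq' := hP'.eq_map_castSucc hnp hnc (hP.2.2.1 0) (hunif _ (hP.2.2.1 0)) hne'
    (hP.2.2.2 0).1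
  exact hne 0 (heq.trans heq'.symm)

end IsBergePath

/-- In an `r`-uniform hypergraph with no Berge path of length `r+1` and no Berge
cycle of length `r+1`, every hyperedge containing an endpoint of a Berge path of
length `r` is one of its defining hyperedges. -/
theorem endpoint_edges_are_defining {V : Type*} (r : ℕ) (hr : 3 ≤ r)
    (E : Finset (Finset V)) (hunif : ∀ e ∈ E, e.card = r)
    (hnp : ¬ HasBergePath E (r + 1)) (hnc : ¬ HasBergeCycle E (r + 1))
    (v : Fin (r + 1) → V) (h : Fin r → Finset V) (hP : IsBergePath E r v h) :
    ∀ e ∈ E, (v 0 ∈ e ∨ v (Fin.last r) ∈ e) → ∃ i, e = h i := by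
  rintro e he (h0 | hl)
  · exact hP.exists_eq_of_zero_mem (by omega) hunif hnp hnc he h0
  · obtain ⟨i, hi⟩ := hP.reverse.exists_eq_of_zero_mem (by omega) hunif hnp hnc he
      (by simpa using hl)
    exact ⟨i.rev, hi⟩
end

section
/- Let H be an r-uniform hypergraph (r ≥ 3) that contains no Berge cycle of length r or longer and whose longest Berge path has length exactly r. Then at least one of the following holds: (i) there is a set S of r−1 vertices with |N_H(S)| ≤ 1; (ii) there is a set S of r+1 vertices with |N_H(S)| ≤ r+1. -/
/-- `N_H(S)`: the hyperedges containing at least one vertex of `S`. -/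
def nbrEdges {V : Type*} [DecidableEq V] (E : Finset (Finset V)) (S : Finset V) :
    Finset (Finset V) :=
  E.filter (fun e => ∃ x ∈ S, x ∈ e)

/-- A Berge path of length `k`, with vertices and hyperedges indexed by natural numbers. -/
structure IsNatBergePath {V : Type*} (E : Finset (Finset V)) (k : ℕ)
    (v : ℕ → V) (h : ℕ → Finset V) : Prop where
  vinj : ∀ s t, s ≤ k → t ≤ k → v s = v t → s = t
  hinj : ∀ s t, s < k → t < k → h s = h t → s = t
  mem : ∀ t, t < k → h t ∈ E
  left : ∀ t, t < k → v t ∈ h t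
  right : ∀ t, t < k → v (t + 1) ∈ h t

namespace IsNatBergePath

variable {V : Type*} {E : Finset (Finset V)} {k r : ℕ} {v : ℕ → V} {h : ℕ → Finset V}

theorem hasBergePath (P : IsNatBergePath E k v h) : HasBergePath E k := by
  refine ⟨fun i => v i, fun i => h i, ?_, ?_, fun i => P.mem _ i.2,
    fun i => ⟨by simpa using P.left _ i.2, by simpa using P.right _ i.2⟩⟩
  · intro a b hab
    exact Fin.ext (P.vinj _ _ (by omega) (by omega) hab)
  · intro a b hab
    exact Fin.ext (P.hinj _ _ a.2 b.2 hab)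

theorem exists_of_hasBergePath (hk : 0 < k) (hP : HasBergePath E k) :
    ∃ v h, IsNatBergePath E k v h := by
  obtain ⟨v, h, hv, hh, hE, hi⟩ := hP
  refine ⟨fun t => v ⟨min t k, by omega⟩, fun t => h ⟨min t (k - 1), by omega⟩,
    ?_, ?_, fun t _ => hE _, ?_, ?_⟩
  · intro s t hs ht hst
    have := congrArg Fin.val (hv hst)
    simp only at this
    omega
  · intro s t hs ht hst
    have := congrArg Fin.val (hh hst)
    simp only at this
    omega
  · intro t ht
    convert (hi ⟨min t (k - 1), by omega⟩).1 using 2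
    simp only [Fin.castSucc_mk, Fin.mk.injEq]
    omega
  · intro t ht
    convert (hi ⟨min t (k - 1), by omega⟩).2 using 2
    simp only [Fin.succ_mk, Fin.mk.injEq]
    omega

/-- Reversal of a path. -/
theorem reverse (P : IsNatBergePath E k v h) :
    IsNatBergePath E k (fun t => v (k - t)) (fun t => h (k - 1 - t)) where
  vinj s t hs ht hst := by
    have := P.vinj _ _ (by omega) (by omega) hst
    omega
  hinj s t hs ht hst := by
    have := P.hinj _ _ (by omega) (by omega) hst
    omega
  mem t ht := P.mem _ (by omega)
  left t ht := by
    have := P.right (k - 1 - t) (by omega)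
    rwa [show k - 1 - t + 1 = k - t by omega] at this
  right t ht := by
    have := P.left (k - 1 - t) (by omega)
    rwa [show k - 1 - t = k - (t + 1) by omega] at this ⊢

/-- Replacing the first vertex by another vertex of the first hyperedge. -/
theorem replace_start (P : IsNatBergePath E k v h) {w : V} (hw : w ∈ h 0)
    (hwv : ∀ t, 1 ≤ t → t ≤ k → v t ≠ w) :
    IsNatBergePath E k (fun t => if t = 0 then w else v t) h where
  vinj s t hs ht hst := by
    have := P.vinj s t hs ht
    grind
  hinj := P.hinj
  mem := P.mem
  left t ht := by
    have := P.left t ht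
    grind
  right t ht := by simpa using P.right t ht

/-- Rotation: if the first vertex lies in the hyperedge `h i`, reverse the part before it. -/
theorem rotate (P : IsNatBergePath E k v h) {i : ℕ} (hi : i < k) (hv : v 0 ∈ h i) :
    IsNatBergePath E k (fun t => if t ≤ i then v (i - t) else v t)
      (fun t => if t < i then h (i - 1 - t) else h t) where
  vinj s t hs ht hst := by
    have h₁ := P.vinj (if s ≤ i then i - s else s) (if t ≤ i then i - t else t)
      (by split_ifs <;> omega) (by split_ifs <;> omega) (by simp only [apply_ite v]; exact hst)
    split_ifs at h₁ <;> omega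
  hinj s t hs ht hst := by
    have h₁ := P.hinj (if s < i then i - 1 - s else s) (if t < i then i - 1 - t else t)
      (by split_ifs <;> omega) (by split_ifs <;> omega) (by simp only [apply_ite h]; exact hst)
    split_ifs at h₁ <;> omega
  mem t ht := by
    split_ifs
    · exact P.mem _ (by omega)
    · exact P.mem _ ht
  left t ht := by
    rcases lt_trichotomy t i with hti | rfl | hti
    · have := P.right (i - 1 - t) (by omega)
      rw [show i - 1 - t + 1 = i - t by omega] at this
      simpa [hti, hti.le] using this
    · simpa using hv
    · simpa [hti.not_ge, hti.not_gt] using P.left t ht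
  right t ht := by
    by_cases hti : t < i
    · have := P.left (i - 1 - t) (by omega)
      simpa [hti, Nat.succ_le_of_lt hti, show i - (t + 1) = i - 1 - t by omega] using this
    · simpa [hti, show ¬ t + 1 ≤ i by omega] using P.right t ht

/-- If `v j` lies in the first hyperedge, the path can be rerouted to start with a hyperedge `e`
through `v (j - 1)`, where `e` replaces `h (j - 1)` and a vertex `w` of `e` replaces `v 0`. -/
theorem reroute (P : IsNatBergePath E k v h) {j : ℕ} (hj : 2 ≤ j) (hjk : j ≤ k)
    (hv : v j ∈ h 0) {e : Finset V} (he : e ∈ E) (hev : v (j - 1) ∈ e)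
    (heh : ∀ t, t < k → h t = e → t = j - 1) {w : V} (hw : w ∈ e)
    (hwv : ∀ t, 1 ≤ t → t ≤ k → v t ≠ w) :
    IsNatBergePath E k (fun t => if t = 0 then w else if t < j then v (j - t) else v t)
      (fun t => if t = 0 then e else if t < j then h (j - 1 - t) else h t) where
  vinj s t hs ht hst := by
    have h₁ := P.vinj (if s < j then j - s else s) (if t < j then j - t else t)
    have h₂ := hwv (if s < j then j - s else s)
    have h₃ := hwv (if t < j then j - t else t)
    grind
  hinj s t hs ht hst := by
    have h₁ := P.hinj (if s < j then j - 1 - s else s) (if t < j then j - 1 - t else t)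
    have h₂ := heh (if s < j then j - 1 - s else s)
    have h₃ := heh (if t < j then j - 1 - t else t)
    grind
  mem t ht := by
    split_ifs
    · exact he
    · exact P.mem _ (by omega)
    · exact P.mem _ ht
  left t ht := by
    split_ifs with h₁ h₂
    · exact hw
    · have := P.right (j - 1 - t) (by omega)
      rwa [show j - 1 - t + 1 = j - t by omega] at this
    · exact P.left t ht
  right t ht := by
    rcases Nat.eq_zero_or_pos t with rfl | h₀
    · simpa [show 1 < j by omega] using hev
    rcases lt_trichotomy (t + 1) j with h₁ | rfl | h₁
    · have := P.left (j - 1 - t) (by omega)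
      simpa [h₁, h₀.ne', show t < j by omega, show j - (t + 1) = j - 1 - t by omega] using this
    · simpa [h₀.ne'] using hv
    · simpa [h₀.ne', show ¬ t < j by omega, show ¬ t + 1 < j by omega] using P.right t ht

/-- Adding a new hyperedge and a new vertex in front of a path. -/
theorem cons (P : IsNatBergePath E k v h) {e : Finset V} (he : e ∈ E) (hev : v 0 ∈ e)
    (heh : ∀ t, t < k → h t ≠ e) {w : V} (hw : w ∈ e) (hwv : ∀ t, t ≤ k → v t ≠ w) :
    IsNatBergePath E (k + 1) (fun t => if t = 0 then w else v (t - 1))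
      (fun t => if t = 0 then e else h (t - 1)) where
  vinj s t hs ht hst := by
    have h₁ := P.vinj (s - 1) (t - 1)
    have h₂ := hwv (s - 1)
    have h₃ := hwv (t - 1)
    grind
  hinj s t hs ht hst := by
    have h₁ := P.hinj (s - 1) (t - 1)
    have h₂ := heh (s - 1)
    have h₃ := heh (t - 1)
    grind
  mem t ht := by
    split_ifs
    · exact he
    · exact P.mem _ (by omega)
  left t ht := by
    split_ifs with h₁
    · exact hw
    · exact P.left _ (by omega)
  right t ht := by
    rcases t with _ | t
    · simpa using hev
    · simpa using P.right t (by omega)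

/-- The first `k + 1` vertices of a path, together with a hyperedge through the first and last of
them, form a Berge cycle. -/
theorem hasBergeCycle (P : IsNatBergePath E k v h) {e : Finset V} (he : e ∈ E)
    (heh : ∀ t, t < k → h t ≠ e) (h₀ : v 0 ∈ e) (h₁ : v k ∈ e) : HasBergeCycle E (k + 1) := by
  refine ⟨fun i => v i, fun i => if (i : ℕ) < k then h i else e, ?_, ?_, ?_, ?_⟩
  · intro a b hab
    exact Fin.ext (P.vinj _ _ (by omega) (by omega) hab)
  · intro a b hab
    have h₁ := P.hinj a b
    have h₂ := heh a
    have h₃ := heh b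
    apply Fin.ext
    have := a.2
    have := b.2
    grind
  · intro i
    dsimp only
    split_ifs with hi
    · exact P.mem _ hi
    · exact he
  · intro i
    by_cases hi : (i : ℕ) < k
    · have h₂ : ((i : ℕ) + 1) % (k + 1) = i + 1 := Nat.mod_eq_of_lt (by omega)
      simp only [hi, if_true, h₂]
      exact ⟨P.left _ hi, P.right _ hi⟩
    · have h₃ : (i : ℕ) = k := by omega
      simp [h₃, h₀, h₁]

/-- The initial part of a path. -/
theorem take (P : IsNatBergePath E k v h) {l : ℕ} (hl : l ≤ k) : IsNatBergePath E l v h where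
  vinj s t hs ht := P.vinj s t (by omega) (by omega)
  hinj s t hs ht := P.hinj s t (by omega) (by omega)
  mem t ht := P.mem t (by omega)
  left t ht := P.left t (by omega)
  right t ht := P.right t (by omega)

/-- The hypergraph is `r`-uniform, without Berge cycles of length at least `r` and without Berge
paths of length more than `r`. -/
structure IsTight {V : Type*} (E : Finset (Finset V)) (r : ℕ) : Prop where
  three_le : 3 ≤ r
  card_eq : ∀ e ∈ E, e.card = r
  no_cycle : ∀ m, r ≤ m → ¬ HasBergeCycle E m
  no_path : ∀ m, r < m → ¬ HasBergePath E m

/-- Every hyperedge through `x` is one of `h 0, …, h (k - 1)`. -/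
def Absorbed {V : Type*} (E : Finset (Finset V)) (k : ℕ) (h : ℕ → Finset V) (x : V) : Prop :=
  ∀ e ∈ E, x ∈ e → ∃ t, t < k ∧ h t = e

theorem Absorbed.of_range {h' : ℕ → Finset V} {x : V} (hx : Absorbed E k h' x)
    (hh : ∀ t, t < k → ∃ s, s < k ∧ h s = h' t) : Absorbed E k h x := by
  intro e he hxe
  obtain ⟨t, ht, rfl⟩ := hx e he hxe
  exact hh t ht

/-- The first vertex is not in the last hyperedge. -/
theorem start_notMem_last (T : IsTight E r) (P : IsNatBergePath E r v h) : v 0 ∉ h (r - 1) := by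
  have hr := T.three_le
  intro h₀
  refine T.no_cycle (r - 1 + 1) (by omega) ((P.take (l := r - 1) (by omega)).hasBergeCycle
    (P.mem (r - 1) (by omega)) ?_ h₀ (P.left _ (by omega)))
  intro t ht hte
  have := P.hinj _ _ (by omega) (by omega) hte
  omega

/-- The last vertex is not in the first hyperedge. -/
theorem last_notMem_first (T : IsTight E r) (P : IsNatBergePath E r v h) : v r ∉ h 0 := by
  simpa using P.reverse.start_notMem_last T

theorem absorbed_start (T : IsTight E r) (P : IsNatBergePath E r v h) : Absorbed E r h (v 0) := by
  classical
  have hr := T.three_le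
  intro e he hev
  by_contra! hcon
  by_cases hsub : ∃ w ∈ e, ∀ t, t ≤ r → v t ≠ w
  · obtain ⟨w, hw, hwv⟩ := hsub
    exact T.no_path (r + 1) (by omega) (P.cons he hev hcon hw hwv).hasBergePath
  · push Not at hsub
    have h₁ : v r ∉ e := fun hre =>
      T.no_cycle (r + 1) (by omega) (P.hasBergeCycle he hcon hev hre)
    have h₂ : v (r - 1) ∉ e := fun hre => T.no_cycle (r - 1 + 1) (by omega)
      ((P.take (l := r - 1) (by omega)).hasBergeCycle he (fun t ht => hcon t (by omega)) hev hre)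
    have h₃ : e ⊆ (Finset.range (r - 1)).image v := by
      intro w hw
      obtain ⟨t, ht, rfl⟩ := hsub w hw
      refine Finset.mem_image_of_mem _ (Finset.mem_range.2 ?_)
      rcases Nat.lt_or_ge t (r - 1) with hlt | hge
      · exact hlt
      · obtain rfl | rfl : t = r ∨ t = r - 1 := by omega
        · exact absurd hw h₁
        · exact absurd hw h₂
    have h₄ := (Finset.card_le_card h₃).trans Finset.card_image_le
    rw [T.card_eq e he, Finset.card_range] at h₄
    omega

theorem Absorbed.of_reverse {x : V} (hx : Absorbed E k (fun t => h (k - 1 - t)) x) :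
    Absorbed E k h x :=
  hx.of_range fun t _ => ⟨k - 1 - t, by omega, rfl⟩

theorem absorbed_last (T : IsTight E r) (P : IsNatBergePath E r v h) : Absorbed E r h (v r) :=
  (P.reverse.absorbed_start T).of_reverse

theorem absorbed_of_mem_first (T : IsTight E r) (P : IsNatBergePath E r v h) {w : V}
    (hw : w ∈ h 0) (hwv : ∀ t, 1 ≤ t → t ≤ r → v t ≠ w) : Absorbed E r h w := by
  simpa using (P.replace_start hw hwv).absorbed_start T

theorem absorbed_of_mem_last (T : IsTight E r) (P : IsNatBergePath E r v h) {w : V}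
    (hw : w ∈ h (r - 1)) (hwv : ∀ t, t ≤ r → v t ≠ w) : Absorbed E r h w :=
  (P.reverse.absorbed_of_mem_first T (by simpa using hw)
    (fun _ _ _ => hwv _ (by omega))).of_reverse

theorem absorbed_of_start_mem (T : IsTight E r) (P : IsNatBergePath E r v h) {i : ℕ}
    (hi : i < r) (hv : v 0 ∈ h i) : Absorbed E r h (v i) := by
  have h₁ := (P.rotate hi hv).absorbed_start T
  simp only [Nat.zero_le, if_true, Nat.sub_zero] at h₁
  refine h₁.of_range fun t ht => ?_
  split_ifs
  · exact ⟨_, by omega, rfl⟩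
  · exact ⟨_, ht, rfl⟩

theorem absorbed_of_last_mem (T : IsTight E r) (P : IsNatBergePath E r v h) {j : ℕ}
    (hj : 1 ≤ j) (hjr : j ≤ r) (hv : v r ∈ h (j - 1)) : Absorbed E r h (v j) := by
  have h₁ := P.reverse.absorbed_of_start_mem T (i := r - j) (by omega)
    (by simpa [show r - 1 - (r - j) = j - 1 by omega] using hv)
  simp only [Nat.sub_sub_self hjr] at h₁
  exact h₁.of_reverse

/-- Rerouting through a hyperedge of the path. -/
theorem reroute_self (P : IsNatBergePath E k v h) {j : ℕ} (hj : 2 ≤ j) (hjk : j ≤ k)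
    (hv : v j ∈ h 0) {w : V} (hw : w ∈ h (j - 1)) (hwv : ∀ t, 1 ≤ t → t ≤ k → v t ≠ w) :
    IsNatBergePath E k (fun t => if t = 0 then w else if t < j then v (j - t) else v t)
      (fun t => if t = 0 then h (j - 1) else if t < j then h (j - 1 - t) else h t) :=
  P.reroute hj hjk hv (P.mem _ (by omega)) (P.left _ (by omega))
    (fun t ht hte => P.hinj _ _ ht (by omega) hte) hw hwv

theorem Absorbed.of_reroute {j : ℕ} {x : V} (hj : 2 ≤ j) (hjk : j ≤ k)
    (hx : Absorbed E k
      (fun t => if t = 0 then h (j - 1) else if t < j then h (j - 1 - t) else h t) x) :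
    Absorbed E k h x := by
  refine hx.of_range fun t ht => ?_
  split_ifs
  · exact ⟨_, by omega, rfl⟩
  · exact ⟨_, by omega, rfl⟩
  · exact ⟨_, ht, rfl⟩

theorem absorbed_of_reroute (T : IsTight E r) (P : IsNatBergePath E r v h) {j : ℕ} (hj : 2 ≤ j)
    (hjr : j ≤ r) (hv : v j ∈ h 0) {w : V} (hw : w ∈ h (j - 1))
    (hwv : ∀ t, 1 ≤ t → t ≤ r → v t ≠ w) : Absorbed E r h w := by
  have h₁ := (P.reroute_self hj hjr hv hw hwv).absorbed_start T
  simp only [if_true] at h₁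
  exact h₁.of_reroute hj hjr

theorem absorbed_of_reroute_of_mem (T : IsTight E r) (P : IsNatBergePath E r v h) {i j : ℕ}
    (hi : 1 ≤ i) (hij : i < j) (hjr : j ≤ r) (hv : v j ∈ h 0) {w : V} (hw : w ∈ h (j - 1))
    (hw' : w ∈ h (i - 1)) (hwv : ∀ t, 1 ≤ t → t ≤ r → v t ≠ w) : Absorbed E r h (v i) := by
  have h₁ := (P.reroute_self (by omega) hjr hv hw hwv).absorbed_of_start_mem T (i := j - i)
    (by omega) (by
      simpa [show ¬ j - i = 0 by omega, show j - i < j by omega,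
        show j - 1 - (j - i) = i - 1 by omega] using hw')
  simp only [show ¬ j - i = 0 by omega, show j - i < j by omega, if_false, if_true,
    show j - (j - i) = i by omega] at h₁
  exact h₁.of_reroute (by omega) hjr

theorem notMem_last_of_reroute (T : IsTight E r) (P : IsNatBergePath E r v h) {j : ℕ}
    (hj : 2 ≤ j) (hjr : j < r) (hv : v j ∈ h 0) {w : V} (hw : w ∈ h (j - 1))
    (hwv : ∀ t, 1 ≤ t → t ≤ r → v t ≠ w) : w ∉ h (r - 1) := by
  have h₁ := (P.reroute_self hj hjr.le hv hw hwv).start_notMem_last T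
  simpa [show ¬ r - 1 = 0 by omega, show ¬ r - 1 < j by omega] using h₁

/-- Rerouting through a new hyperedge `e`. -/
theorem eq_or_exists_of_reroute (T : IsTight E r) (P : IsNatBergePath E r v h) {j : ℕ}
    (hj : 2 ≤ j) (hjr : j ≤ r) (hv : v j ∈ h 0) {e : Finset V} (he : e ∈ E)
    (hev : v (j - 1) ∈ e) (heh : ∀ t, t < r → h t ≠ e) {w : V} (hw : w ∈ e)
    (hwv : ∀ t, 1 ≤ t → t ≤ r → v t ≠ w) {e' : Finset V} (he' : e' ∈ E) (hwe' : w ∈ e') :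
    e' = e ∨ ∃ t, t < r ∧ h t = e' := by
  have h₁ := (P.reroute hj hjr hv he hev (fun t ht hte => absurd hte (heh t ht)) hw
    hwv).absorbed_start T e' he' hwe'
  obtain ⟨t, ht, rfl⟩ := h₁
  split_ifs
  · exact Or.inl rfl
  · exact Or.inr ⟨_, by omega, rfl⟩
  · exact Or.inr ⟨_, ht, rfl⟩

variable [DecidableEq V]

theorem card_image (P : IsNatBergePath E k v h) {s : Finset ℕ} (hs : ∀ t ∈ s, t ≤ k) :
    (s.image v).card = s.card :=
  Finset.card_image_of_injOn fun a ha b hb => P.vinj a b (hs a ha) (hs b hb)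

/-- The number of vertices of the first hyperedge which are not vertices of the path. -/
def startExcess (k : ℕ) (v : ℕ → V) (h : ℕ → Finset V) : ℕ :=
  (h 0 \ (Finset.range (k + 1)).image v).card

/-- In a path minimizing `startExcess`, an absorbed vertex can be assigned to every vertex `v j`,
`2 ≤ j`, of the first hyperedge. -/
theorem exists_absorbed (T : IsTight E r) (P : IsNatBergePath E r v h)
    (hmin : ∀ v' h', IsNatBergePath E r v' h' → startExcess r v h ≤ startExcess r v' h')
    {j : ℕ} (hj : 2 ≤ j) (hjr : j < r) (hv : v j ∈ h 0) :
    ∃ y, Absorbed E r h y ∧ (y = v j ∨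
      ((∀ t, t ≤ r → v t ≠ y) ∧ y ∈ h (j - 1) ∧ y ∉ h 0 ∧ ¬ Absorbed E r h (v j)) ∨
      (y = v 1 ∧ v 0 ∈ h (j - 1) ∧ ¬ Absorbed E r h (v j))) := by
  by_cases hA : Absorbed E r h (v j)
  · exact ⟨_, hA, Or.inl rfl⟩
  by_cases hy : ∃ y ∈ h (j - 1), y ∉ h 0 ∧ ∀ t, t ≤ r → v t ≠ y
  · obtain ⟨y, hy₁, hy₂, hy₃⟩ := hy
    exact ⟨y, P.absorbed_of_reroute T hj hjr.le hv hy₁ (fun t _ => hy₃ t),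
      Or.inr (Or.inl ⟨hy₃, hy₁, hy₂, hA⟩)⟩
  push Not at hy
  have h₀ : ∀ t, 1 ≤ t → t ≤ r → v t ≠ v 0 := fun t ht htr hvt => by
    have := P.vinj _ _ htr (by omega) hvt
    omega
  suffices hv₀ : v 0 ∈ h (j - 1) from
    ⟨v 1, P.absorbed_of_reroute_of_mem T le_rfl (by omega) hjr.le hv hv₀
      (P.left 0 (by omega)) h₀, Or.inr (Or.inr ⟨rfl, hv₀, hA⟩)⟩
  by_contra hv₀
  have hvr : v r ∉ h (j - 1) := fun hvr => hA (P.absorbed_of_last_mem T (by omega) hjr.le hvr)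
  obtain ⟨u, hu, huv⟩ : ∃ u ∈ h (j - 1), ∀ t, t ≤ r → v t ≠ u := by
    by_contra! hcon
    have h₁ : h (j - 1) ⊆ (Finset.Ioo 0 r).image v := by
      intro x hx
      obtain ⟨t, ht, rfl⟩ := hcon x hx
      refine Finset.mem_image_of_mem _ (Finset.mem_Ioo.2 ⟨?_, ?_⟩)
      · by_contra ht₀
        obtain rfl : t = 0 := by omega
        exact hv₀ hx
      · refine lt_of_le_of_ne ht ?_
        rintro rfl
        exact hvr hx
    have h₂ := (Finset.card_le_card h₁).trans Finset.card_image_le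
    rw [T.card_eq _ (P.mem _ (by omega)), Nat.card_Ioo] at h₂
    omega
  have h₁ := hmin _ _ (P.reroute_self hj hjr.le hv hu (fun t _ => huv t))
  refine absurd h₁ (not_le.2 (Finset.card_lt_card ?_))
  simp only [if_true]
  refine (Finset.ssubset_iff_of_subset ?_).2 ⟨u, ?_, ?_⟩
  · intro x hx
    simp only [Finset.mem_sdiff, Finset.mem_image, Finset.mem_range, not_exists, not_and] at hx ⊢
    have hxv : ∀ t, t < r + 1 → v t ≠ x := by
      rintro t ht rfl
      rcases Nat.eq_zero_or_pos t with rfl | ht₀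
      · exact hv₀ hx.1
      by_cases htj : t < j
      · refine hx.2 (j - t) (by omega) ?_
        rw [if_neg (by omega), if_pos (by omega), Nat.sub_sub_self htj.le]
      · refine hx.2 t ht ?_
        rw [if_neg (by omega), if_neg htj]
    refine ⟨?_, hxv⟩
    by_contra hx₀
    obtain ⟨t, ht, htx⟩ := hy x hx.1 hx₀
    exact hxv t (by omega) htx
  · simp only [Finset.mem_sdiff, Finset.mem_image, Finset.mem_range, not_exists, not_and]
    refine ⟨?_, fun t ht => huv t (by omega)⟩
    by_contra hu₀
    obtain ⟨t, ht, htu⟩ := hy u hu hu₀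
    exact huv t ht htu
  · simp only [Finset.mem_sdiff, Finset.mem_image, Finset.mem_range, not_and, not_not]
    exact fun _ => ⟨0, by omega, by simp⟩

/-- A path minimizing `startExcess` has at least `r` absorbed vertices, not counting those in the
last hyperedge outside the path. -/
theorem exists_absorbed_finset (T : IsTight E r) (P : IsNatBergePath E r v h)
    (hmin : ∀ v' h', IsNatBergePath E r v' h' → startExcess r v h ≤ startExcess r v' h') :
    ∃ S : Finset V, r ≤ S.card ∧ (∀ x ∈ S, Absorbed E r h x) ∧
      ∀ x ∈ h (r - 1), (∀ t, t ≤ r → v t ≠ x) → x ∉ S := by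
  have hr := T.three_le
  have hvr := P.last_notMem_first T
  set B := (Finset.Ico 2 r).filter (fun j => v j ∈ h 0) with hB
  set W := h 0 \ (Finset.Icc 1 r).image v with hW
  have hmemB : ∀ j, j ∈ B ↔ (2 ≤ j ∧ j < r) ∧ v j ∈ h 0 := by simp [hB]
  have hmemW : ∀ x, x ∈ W ↔ x ∈ h 0 ∧ ∀ t, 1 ≤ t → t ≤ r → v t ≠ x := by simp [hW]
  have hcard : r ≤ W.card + B.card + 1 := by
    have h₁ : h 0 ⊆ W ∪ (insert 1 B).image v := by
      intro x hx
      by_cases hxW : x ∈ W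
      · exact Finset.mem_union_left _ hxW
      · rw [hmemW] at hxW
        push Not at hxW
        obtain ⟨t, ht₁, htr, rfl⟩ := hxW hx
        refine Finset.mem_union_right _ (Finset.mem_image_of_mem _ ?_)
        rw [Finset.mem_insert, hmemB]
        by_cases h₁ : t = 1
        · exact Or.inl h₁
        · refine Or.inr ⟨⟨by omega, lt_of_le_of_ne htr ?_⟩, hx⟩
          rintro rfl
          exact hvr hx
    have h₂ := Finset.card_le_card h₁
    have h₃ := Finset.card_union_le W ((insert 1 B).image v)
    have h₄ := (Finset.card_image_le (f := v) (s := insert 1 B)).trans (Finset.card_insert_le 1 B)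
    rw [T.card_eq _ (P.mem 0 (by omega))] at h₂
    omega
  have hex : ∀ j, ∃ y, j ∈ B → Absorbed E r h y ∧ (y = v j ∨
      ((∀ t, t ≤ r → v t ≠ y) ∧ y ∈ h (j - 1) ∧ y ∉ h 0 ∧ ¬ Absorbed E r h (v j)) ∨
      (y = v 1 ∧ v 0 ∈ h (j - 1) ∧ ¬ Absorbed E r h (v j))) := by
    intro j
    by_cases hj : j ∈ B
    · obtain ⟨⟨h₁, h₂⟩, h₃⟩ := (hmemB j).1 hj
      obtain ⟨y, hy⟩ := P.exists_absorbed T hmin h₁ h₂ h₃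
      exact ⟨y, fun _ => hy⟩
    · exact ⟨v 0, fun h => absurd h hj⟩
  choose f hfA hf using fun j => (hex j).imp fun y hy => forall_and.1 hy
  have hlt : ∀ i ∈ B, ∀ j ∈ B, i < j → f i ≠ f j := by
    intro i hi j hj hij hfij
    obtain ⟨⟨hi₁, hi₂⟩, hi₃⟩ := (hmemB i).1 hi
    obtain ⟨⟨hj₁, hj₂⟩, hj₃⟩ := (hmemB j).1 hj
    have hinj := P.vinj i j (by omega) (by omega)
    have hi1 := P.vinj i 1 (by omega) (by omega)
    have hj1 := P.vinj j 1 (by omega) (by omega)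
    have h₀ : ∀ t, 1 ≤ t → t ≤ r → v t ≠ v 0 := fun t ht htr hvt => by
      have := P.vinj _ _ htr (by omega) hvt
      omega
    rcases hf i hi with h₁ | ⟨h₁, h₁', -, h₁''⟩ | ⟨h₁, h₁', h₁''⟩ <;>
    rcases hf j hj with h₂ | ⟨h₂, h₂', -, h₂''⟩ | ⟨h₂, h₂', h₂''⟩
    · exact hij.ne (hinj (by rw [← h₁, ← h₂, hfij]))
    · exact h₂ i (by omega) (by rw [← h₁, hfij])
    · have := hi1 (by rw [← h₁, ← h₂, hfij])
      omega
    · exact h₁ j (by omega) (by rw [← h₂, hfij])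
    · exact h₁'' (P.absorbed_of_reroute_of_mem T (by omega) hij hj₂.le hj₃ h₂'
        (hfij ▸ h₁') (fun t _ => h₂ t))
    · exact h₁ 1 (by omega) (by rw [← h₂, hfij])
    · have := hj1 (by rw [← h₁, ← h₂, hfij])
      omega
    · exact h₂ 1 (by omega) (by rw [← h₁, hfij])
    · exact h₁'' (P.absorbed_of_reroute_of_mem T (by omega) hij hj₂.le hj₃ h₂' h₁' h₀)
  have hfinj : Set.InjOn f B := by
    intro i hi j hj hfij
    rcases lt_trichotomy i j with hij | hij | hij
    · exact absurd hfij (hlt i hi j hj hij)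
    · exact hij
    · exact absurd hfij.symm (hlt j hj i hi hij)
  have hdisj : Disjoint W (B.image f) := by
    rw [Finset.disjoint_left]
    intro x hx hxf
    obtain ⟨j, hj, rfl⟩ := Finset.mem_image.1 hxf
    obtain ⟨⟨hj₁, hj₂⟩, hj₃⟩ := (hmemB j).1 hj
    obtain ⟨hx₁, hx₂⟩ := (hmemW _).1 hx
    rcases hf j hj with h₁ | ⟨-, -, h₁, -⟩ | ⟨h₁, -, -⟩
    · exact hx₂ j (by omega) hj₂.le h₁.symm
    · exact h₁ hx₁
    · exact hx₂ 1 le_rfl (by omega) h₁.symm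
  have hvrS : v r ∉ W ∪ B.image f := by
    rw [Finset.mem_union, not_or]
    refine ⟨fun hvW => hvr ((hmemW _).1 hvW).1, fun hvf => ?_⟩
    obtain ⟨j, hj, hjf⟩ := Finset.mem_image.1 hvf
    obtain ⟨⟨hj₁, hj₂⟩, hj₃⟩ := (hmemB j).1 hj
    rcases hf j hj with h₁ | ⟨h₁, -, -, -⟩ | ⟨h₁, -, -⟩
    · have := P.vinj r j le_rfl hj₂.le (by rw [← h₁, hjf])
      omega
    · exact h₁ r le_rfl hjf.symm
    · have := P.vinj r 1 le_rfl (by omega) (by rw [← h₁, hjf])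
      omega
  refine ⟨insert (v r) (W ∪ B.image f), ?_, ?_, ?_⟩
  · rw [Finset.card_insert_of_notMem hvrS, Finset.card_union_of_disjoint hdisj,
      Finset.card_image_of_injOn hfinj]
    omega
  · intro x hx
    rw [Finset.mem_insert, Finset.mem_union, Finset.mem_image] at hx
    rcases hx with rfl | hx | ⟨j, hj, rfl⟩
    · exact P.absorbed_last T
    · obtain ⟨hx₁, hx₂⟩ := (hmemW _).1 hx
      exact P.absorbed_of_mem_first T hx₁ hx₂
    · exact hfA j hj
  · intro x hx hxv hxS
    rw [Finset.mem_insert, Finset.mem_union, Finset.mem_image] at hxS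
    rcases hxS with rfl | hxS | ⟨j, hj, rfl⟩
    · exact hxv r le_rfl rfl
    · obtain ⟨hx₁, hx₂⟩ := (hmemW _).1 hxS
      exact (P.replace_start hx₁ hx₂).start_notMem_last T (by simpa using hx)
    · obtain ⟨⟨hj₁, hj₂⟩, hj₃⟩ := (hmemB j).1 hj
      rcases hf j hj with h₁ | ⟨h₁, h₁', -, -⟩ | ⟨h₁, -, -⟩
      · exact hxv j hj₂.le h₁.symm
      · exact P.notMem_last_of_reroute T hj₁ hj₂ hj₃ h₁' (fun t _ => h₁ t) hx
      · exact hxv 1 (by omega) h₁.symm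

/-- If the first hyperedge consists of path vertices, it contains all of them but the last. -/
theorem mem_first_of_subset (T : IsTight E r) (P : IsNatBergePath E r v h)
    (hsub : ∀ x ∈ h 0, ∃ t, t ≤ r ∧ v t = x) {t : ℕ} (ht : t < r) : v t ∈ h 0 := by
  have hr := T.three_le
  have h₁ : h 0 ⊆ (Finset.range r).image v := by
    intro x hx
    obtain ⟨s, hs, rfl⟩ := hsub x hx
    refine Finset.mem_image_of_mem _ (Finset.mem_range.2 (lt_of_le_of_ne hs ?_))
    rintro rfl
    exact P.last_notMem_first T hx
  rw [Finset.eq_of_subset_of_card_le h₁ (Finset.card_image_le.trans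
    (by rw [T.card_eq _ (P.mem 0 (by omega)), Finset.card_range]))]
  exact Finset.mem_image_of_mem _ (Finset.mem_range.2 ht)

end IsNatBergePath

theorem exists_card_nbrEdges_le {V : Type*} [DecidableEq V] {E : Finset (Finset V)} {r : ℕ}
    {S : Finset V} {F : Finset (Finset V)} (hS : r + 1 ≤ S.card) (hF : F.card ≤ r + 1)
    (hSF : ∀ x ∈ S, ∀ e ∈ E, x ∈ e → e ∈ F) :
    ∃ S : Finset V, S.card = r + 1 ∧ (nbrEdges E S).card ≤ r + 1 := by
  obtain ⟨S', hS', hcard⟩ := Finset.exists_subset_card_eq hS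
  refine ⟨S', hcard, (Finset.card_le_card ?_).trans hF⟩
  intro e he
  obtain ⟨he, x, hx, hxe⟩ := Finset.mem_filter.1 he
  exact hSF x (hS' hx) e he hxe

/-- If an `r`-uniform hypergraph has no Berge cycle of length `≥ r` and its longest
Berge path has length exactly `r`, then either some `(r−1)`-set `S` has
`|N_H(S)| ≤ 1`, or some `(r+1)`-set `S` has `|N_H(S)| ≤ r+1`. -/
theorem small_neighborhood_set {V : Type*} [DecidableEq V] (r : ℕ) (hr : 3 ≤ r)
    (E : Finset (Finset V)) (hunif : ∀ e ∈ E, e.card = r)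
    (hnc : ∀ m, r ≤ m → ¬ HasBergeCycle E m)
    (hp : HasBergePath E r) (hlong : ∀ m, r < m → ¬ HasBergePath E m) :
    (∃ S : Finset V, S.card = r - 1 ∧ (nbrEdges E S).card ≤ 1) ∨
    (∃ S : Finset V, S.card = r + 1 ∧ (nbrEdges E S).card ≤ r + 1) := by
  have T : IsNatBergePath.IsTight E r := ⟨hr, hunif, hnc, hlong⟩
  obtain ⟨v₀, h₀, P₀⟩ := IsNatBergePath.exists_of_hasBergePath (by omega) hp
  obtain ⟨⟨v, h⟩, P, hmin⟩ := (measure fun p : (ℕ → V) × (ℕ → Finset V) =>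
    IsNatBergePath.startExcess r p.1 p.2).wf.has_min
      {p | IsNatBergePath E r p.1 p.2} ⟨(v₀, h₀), P₀⟩
  replace P : IsNatBergePath E r v h := P
  replace hmin : ∀ v' h', IsNatBergePath E r v' h' →
      IsNatBergePath.startExcess r v h ≤ IsNatBergePath.startExcess r v' h' :=
    fun v' h' P' => not_lt.1 (hmin (v', h') P')
  obtain ⟨S, hScard, hSA, hSlast⟩ := P.exists_absorbed_finset T hmin
  right
  set F := (Finset.range r).image h with hF
  have hFcard : F.card ≤ r := Finset.card_image_le.trans (Finset.card_range r).le
  have hAF : ∀ x, IsNatBergePath.Absorbed E r h x → ∀ e ∈ E, x ∈ e → e ∈ F := by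
    intro x hx e he hxe
    obtain ⟨t, ht, rfl⟩ := hx e he hxe
    exact Finset.mem_image_of_mem _ (Finset.mem_range.2 ht)
  by_cases hlast : ∃ x ∈ h (r - 1), ∀ t, t ≤ r → v t ≠ x
  · obtain ⟨x, hx, hxv⟩ := hlast
    refine exists_card_nbrEdges_le (S := insert x S) (F := F) ?_ (by omega) ?_
    · rw [Finset.card_insert_of_notMem (hSlast x hx hxv)]
      omega
    · intro y hy
      rcases Finset.mem_insert.1 hy with rfl | hy
      · exact hAF _ (P.absorbed_of_mem_last T hx hxv)
      · exact hAF _ (hSA y hy)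
  push Not at hlast
  have hlast' : ∀ t, 1 ≤ t → t ≤ r → v t ∈ h (r - 1) := by
    intro t ht htr
    have h₁ := P.reverse.mem_first_of_subset T (t := r - t) (by
      intro x hx
      obtain ⟨s, hs, rfl⟩ := hlast x (by simpa using hx)
      exact ⟨r - s, by omega, by simp [Nat.sub_sub_self hs]⟩) (by omega)
    simpa [Nat.sub_sub_self htr] using h₁
  have hfirst : ∀ t, t < r → v t ∈ h 0 := by
    intro t ht
    refine P.mem_first_of_subset T ?_ ht
    have h₁ := hmin _ _ P.reverse
    have h₂ : IsNatBergePath.startExcess r (fun t => v (r - t)) (fun t => h (r - 1 - t)) = 0 := by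
      simp only [IsNatBergePath.startExcess, Finset.card_eq_zero, Finset.sdiff_eq_empty_iff_subset]
      intro x hx
      obtain ⟨s, hs, rfl⟩ := hlast x (by simpa using hx)
      exact Finset.mem_image.2 ⟨r - s, by simp, by simp [Nat.sub_sub_self hs]⟩
    rw [h₂, Nat.le_zero] at h₁
    simp only [IsNatBergePath.startExcess, Finset.card_eq_zero,
      Finset.sdiff_eq_empty_iff_subset] at h₁
    intro x hx
    obtain ⟨s, hs, rfl⟩ := Finset.mem_image.1 (h₁ hx)
    exact ⟨s, Nat.lt_succ_iff.1 (Finset.mem_range.1 hs), rfl⟩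
  by_cases hall : ∀ t, t ≤ r → IsNatBergePath.Absorbed E r h (v t)
  · refine exists_card_nbrEdges_le (S := (Finset.range (r + 1)).image v) (F := F) ?_ (by omega) ?_
    · rw [P.card_image (fun t ht => Nat.lt_succ_iff.1 (Finset.mem_range.1 ht)), Finset.card_range]
    · intro x hx
      obtain ⟨t, ht, rfl⟩ := Finset.mem_image.1 hx
      exact hAF _ (hall t (Nat.lt_succ_iff.1 (Finset.mem_range.1 ht)))
  simp only [IsNatBergePath.Absorbed] at hall
  push Not at hall
  obtain ⟨l, hl, e, he, hle, heh⟩ := hall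
  have h₁ : v 0 ∉ e := fun h₁ => by
    obtain ⟨t, ht, hte⟩ := P.absorbed_start T e he h₁
    exact heh t ht hte
  have h₂ : v r ∉ e := fun h₂ => by
    obtain ⟨t, ht, hte⟩ := P.absorbed_last T e he h₂
    exact heh t ht hte
  have hl₀ : l ≠ 0 := by
    rintro rfl
    exact h₁ hle
  have hlr : l ≠ r := by
    rintro rfl
    exact h₂ hle
  obtain ⟨x, hx, hxv⟩ : ∃ x ∈ e, ∀ t, t ≤ r → v t ≠ x := by
    by_contra! hcon
    have h₃ : e ⊆ (Finset.Ioo 0 r).image v := by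
      intro x hx
      obtain ⟨t, ht, rfl⟩ := hcon x hx
      refine Finset.mem_image_of_mem _ (Finset.mem_Ioo.2 ⟨?_, ?_⟩)
      · refine Nat.pos_of_ne_zero ?_
        rintro rfl
        exact h₁ hx
      · refine lt_of_le_of_ne ht ?_
        rintro rfl
        exact h₂ hx
    have h₄ := (Finset.card_le_card h₃).trans Finset.card_image_le
    rw [hunif e he, Nat.card_Ioo] at h₄
    omega
  have hxe : ∀ e' ∈ E, x ∈ e' → e' ∈ insert e F := by
    intro e' he' hxe'
    have h₃ : e' = e ∨ ∃ t, t < r ∧ h t = e' := by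
      by_cases hl₁ : l + 1 < r
      · exact P.eq_or_exists_of_reroute T (j := l + 1) (by omega) (by omega) (hfirst _ hl₁) he
          hle heh hx (fun t _ => hxv t) he' hxe'
      · obtain rfl : l = r - 1 := by omega
        obtain h₃ | ⟨t, ht, h₃⟩ := P.reverse.eq_or_exists_of_reroute T (j := 2) le_rfl (by omega)
          (by simpa using hlast' (r - 2) (by omega) (by omega)) he hle
          (fun t _ => heh _ (by omega)) hx (fun t _ _ => hxv _ (by omega)) he' hxe'
        · exact Or.inl h₃
        · exact Or.inr ⟨_, by omega, h₃⟩
    rcases h₃ with rfl | ⟨t, ht, rfl⟩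
    · exact Finset.mem_insert_self _ _
    · exact Finset.mem_insert_of_mem (Finset.mem_image_of_mem _ (Finset.mem_range.2 ht))
  have hxS : x ∉ S := fun hxS => by
    obtain ⟨t, ht, hte⟩ := hSA x hxS e he hx
    exact heh t ht hte
  refine exists_card_nbrEdges_le (S := insert x S) (F := insert e F) ?_
    ((Finset.card_insert_le _ _).trans (by omega)) ?_
  · rw [Finset.card_insert_of_notMem hxS]
    omega
  · intro y hy
    rcases Finset.mem_insert.1 hy with rfl | hy
    · exact hxe
    · exact fun e' he' hye' => Finset.mem_insert_of_mem (hAF _ (hSA y hy) e' he' hye')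
end

section
/- Let F be a graph and r ≥ 2. Given any n-vertex r-uniform hypergraph H containing no Berge copy of F, there exists an n-vertex graph G (on the same vertex set) together with a 2-coloring of its edges by red and blue such that G contains no copy of F (ignoring colors) and the number of hyperedges of H is at most N(K_r, G_b) + e(G_r), where G_b is the subgraph of blue edges, G_r is the subgraph of red edges, N(K_r, G_b) is the number of r-cliques in G_b, and e(G_r) is the number of red edges. -/
/-- **Hall's theorem** relative to finsets: if every subset `S` of `A` has at least `S.card`
neighbours, there is a matching saturating `A`. -/
lemma Finset.exists_injective_mem_of_card_le_card_biUnion {α β : Type*} [DecidableEq β]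
    (A : Finset α) (N : α → Finset β) (h : ∀ S ⊆ A, S.card ≤ (S.biUnion N).card) :
    ∃ f : A → β, Function.Injective f ∧ ∀ a : A, f a ∈ N a := by
  classical
  refine (Finset.all_card_le_biUnion_card_iff_exists_injective (fun a : A => N a)).1 fun S => ?_
  have hS := h (S.map (Function.Embedding.subtype _)) (by
    intro a ha
    obtain ⟨b, -, rfl⟩ := Finset.mem_map.1 ha
    exact b.2)
  rwa [Finset.card_map, Finset.map_eq_image, Finset.image_biUnion] at hS

/-- In a finite bipartite graph with classes `A` and `β`, given by the neighbourhoods `N a`,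
there are `A₁ ⊆ A` and disjoint sets `B` and `R` such that `B` contains the neighbourhood of `A₁`,
`R` is at least as large as `A \ A₁`, and some matching into `A` saturates `B ∪ R`. -/
lemma Finset.exists_saturating_matching {α β : Type*} [DecidableEq α] [DecidableEq β]
    (A : Finset α) (N : α → Finset β) :
    ∃ A₁ ⊆ A, ∃ B R : Finset β, (∀ a ∈ A₁, N a ⊆ B) ∧ Disjoint B R ∧
      A.card ≤ A₁.card + R.card ∧ ∃ h : {b // b ∈ B ∪ R} → α,
        Function.Injective h ∧ ∀ b, h b ∈ A ∧ b.1 ∈ N (h b) := by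
  obtain ⟨A₁, hA₁, hmax⟩ := A.powerset.exists_max_image
    (fun S => (S.card : ℤ) - (S.biUnion N).card) ⟨∅, Finset.empty_mem_powerset A⟩
  rw [Finset.mem_powerset] at hA₁
  obtain ⟨g, hg, hgN⟩ := Finset.exists_injective_mem_of_card_le_card_biUnion (A \ A₁)
    (fun a => N a \ A₁.biUnion N) (by
      intro S hS
      have hd : Disjoint A₁ S := Finset.disjoint_sdiff.mono_right hS
      have hm := hmax (A₁ ∪ S) (Finset.mem_powerset.2
        (Finset.union_subset hA₁ (hS.trans Finset.sdiff_subset)))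
      have hU : (A₁ ∪ S).biUnion N =
          A₁.biUnion N ∪ S.biUnion fun a => N a \ A₁.biUnion N := by
        ext b
        simp only [Finset.mem_biUnion, Finset.mem_union, Finset.mem_sdiff]
        grind
      have hc := Finset.card_union_le (A₁.biUnion N) (S.biUnion fun a => N a \ A₁.biUnion N)
      rw [hU, Finset.card_union_of_disjoint hd] at hm
      push_cast at hm
      omega)
  obtain ⟨f, hf, hfN⟩ := Finset.exists_injective_mem_of_card_le_card_biUnion (A₁.biUnion N)
    (fun b => {a ∈ A₁ | b ∈ N a}) (by
      intro T hT
      set C := T.biUnion fun b => {a ∈ A₁ | b ∈ N a}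
      have hC : C ⊆ A₁ := Finset.biUnion_subset.2 fun b _ => Finset.filter_subset _ _
      have hm := hmax (A₁ \ C) (Finset.mem_powerset.2 (Finset.sdiff_subset.trans hA₁))
      have hsub : (A₁ \ C).biUnion N ⊆ A₁.biUnion N \ T := by
        intro b
        simp only [C, Finset.mem_biUnion, Finset.mem_sdiff, Finset.mem_filter]
        grind
      have h1 := Finset.card_le_card hsub
      have h2 := Finset.card_sdiff_add_card_eq_card hT
      have h3 := Finset.card_sdiff_add_card_eq_card hC
      omega)
  have hfN' : ∀ b, f b ∈ A₁ ∧ b.1 ∈ N (f b) := fun b => Finset.mem_filter.1 (hfN b)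
  have hgN' : ∀ a : ↥(A \ A₁), g a ∈ N a ∧ g a ∉ A₁.biUnion N := fun a => Finset.mem_sdiff.1 (hgN a)
  have hR : ∀ b ∈ Finset.univ.image g, ∃ a, g a = b := by simp
  refine ⟨A₁, hA₁, A₁.biUnion N, Finset.univ.image g,
    fun a ha => Finset.subset_biUnion_of_mem N ha, ?_, ?_, ?_⟩
  · rw [Finset.disjoint_right]
    intro b hb
    obtain ⟨a, rfl⟩ := hR b hb
    exact (hgN' a).2
  · rw [Finset.card_image_of_injective _ hg, Finset.card_univ, Fintype.card_coe]
    have := Finset.card_sdiff_add_card_eq_card hA₁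
    omega
  · choose k hk using hR
    refine ⟨fun b => if hb : b.1 ∈ A₁.biUnion N then f ⟨b, hb⟩
      else k b ((Finset.mem_union.1 b.2).resolve_left hb), ?_, ?_⟩
    · rintro ⟨b, hb⟩ ⟨c, hc⟩ hbc
      dsimp only at hbc
      rw [Subtype.mk.injEq]
      split_ifs at hbc with h1 h2 h2
      · exact congrArg Subtype.val (hf hbc)
      · exact absurd (hbc ▸ (hfN' ⟨b, h1⟩).1) (Finset.mem_sdiff.1 (k c _).2).2
      · exact absurd (hbc ▸ (hfN' ⟨c, h2⟩).1) (Finset.mem_sdiff.1 (k b _).2).2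
      · rw [← hk b ((Finset.mem_union.1 hb).resolve_left h1),
          ← hk c ((Finset.mem_union.1 hc).resolve_left h2), Subtype.ext hbc]
    · rintro ⟨b, hb⟩
      dsimp only
      split_ifs with h1
      · exact ⟨hA₁ (hfN' ⟨b, h1⟩).1, (hfN' ⟨b, h1⟩).2⟩
      · have hb' := (Finset.mem_union.1 hb).resolve_left h1
        refine ⟨(Finset.mem_sdiff.1 (k b hb').2).1, ?_⟩
        have := (hgN' (k b hb')).1
        rwa [hk b hb'] at this

/-- Gerbner–Methuku–Palmer: for every `n`-vertex Berge-`F`-free `r`-uniform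
hypergraph `E` there is a red-blue `n`-vertex graph (an edge-disjoint pair
`Gb`, `Gr` of blue and red edges) whose union is `F`-free, with
`|E| ≤ N(K_r, G_b) + e(G_r)`. -/
theorem berge_free_red_blue_bound {W : Type*} (F : SimpleGraph W) (r n : ℕ)
    (E : Finset (Finset (Fin n))) (hunif : ∀ e ∈ E, e.card = r)
    (hE : ¬ ContainsBergeCopy F E) :
    ∃ Gb Gr : SimpleGraph (Fin n),
      Disjoint Gb Gr ∧
      ¬ ContainsCopy F (Gb ⊔ Gr) ∧
      E.card ≤ Nat.card {s : Finset (Fin n) // Gb.IsNClique r s} + Nat.card Gr.edgeSet := by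
  classical
  obtain ⟨A, hAE, B, R, hAB, hdisj, hcard, h, hinj, hmem⟩ :=
    E.exists_saturating_matching fun e => {p ∈ e.sym2 | ¬ Sym2.IsDiag p}
  have hdiag : ∀ p ∈ B ∪ R, ¬ p.IsDiag := fun p hp =>
    (Finset.mem_filter.1 (hmem ⟨p, hp⟩).2).2
  have hedge : ∀ S ⊆ B ∪ R, (SimpleGraph.fromEdgeSet (S : Set (Sym2 (Fin n)))).edgeSet = S := by
    intro S hS
    rw [SimpleGraph.edgeSet_fromEdgeSet]
    exact sdiff_eq_left.2 (Set.disjoint_left.2 fun p hp => hdiag p (hS hp))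
  refine ⟨SimpleGraph.fromEdgeSet B, SimpleGraph.fromEdgeSet R, ?_, ?_, ?_⟩
  · rw [← SimpleGraph.disjoint_edgeSet, hedge B Finset.subset_union_left,
      hedge R Finset.subset_union_right]
    exact Finset.disjoint_coe.2 hdisj
  · rintro ⟨f, hf, hadj⟩
    have hmap : ∀ e : F.edgeSet, Sym2.map f e ∈ B ∪ R := by
      rintro ⟨e, he⟩
      induction e with | _ a b
      have := hadj a b he
      simp only [SimpleGraph.sup_adj, SimpleGraph.fromEdgeSet_adj, Finset.mem_coe] at this
      exact Finset.mem_union.2 (this.imp And.left And.left)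
    refine hE ⟨f, fun e => h ⟨Sym2.map f e, hmap e⟩, hf, ?_, fun e => (hmem _).1, ?_⟩
    · intro e e' hee
      exact Subtype.ext (Sym2.map.injective hf (congrArg Subtype.val (hinj hee)))
    · intro e w hw
      exact Finset.mem_sym2_iff.1 (Finset.mem_filter.1 (hmem ⟨Sym2.map f e, hmap e⟩).2).1 _
        (Sym2.mem_map.2 ⟨w, hw, rfl⟩)
  · refine hcard.trans (Nat.add_le_add ?_ ?_)
    · have hclique : ∀ e ∈ A, (SimpleGraph.fromEdgeSet (B : Set (Sym2 (Fin n)))).IsNClique r e := by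
        refine fun e he => ⟨fun x hx y hy hxy => ?_, hunif e (hAE he)⟩
        refine (SimpleGraph.fromEdgeSet_adj _).2 ⟨Finset.mem_coe.2 ?_, hxy⟩
        exact hAB e he (Finset.mem_filter.2
          ⟨Finset.mk_mem_sym2_iff.2 ⟨hx, hy⟩, by simpa using hxy⟩)
      rw [← Nat.card_eq_finsetCard A]
      exact Nat.card_le_card_of_injective (fun e : A => ⟨e.1, hclique e e.2⟩) fun a b hab =>
        Subtype.ext (Subtype.mk.inj hab)
    · rw [hedge R Finset.subset_union_right]
      simp
end

section
/- If 3 ≤ r ≤ ℓ ≤ k−2, then (k−ℓ−1)/2 ≤ (C(k−1, r−1) − C(ℓ, r−1))/r, where C(a,b) denotes the binomial coefficient. -/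
/-- Iterating Pascal's rule: raising the upper index by `d` raises the binomial coefficient
by at least `d * C(n, s)`. -/
theorem choose_succ_add_mul_choose_le (n s d : ℕ) :
    n.choose (s + 1) + d * n.choose s ≤ (n + d).choose (s + 1) := by
  induction d with
  | zero => simp
  | succ d ih =>
    have hmono : n.choose s ≤ (n + d).choose s := Nat.choose_le_choose s (Nat.le_add_right n d)
    rw [← Nat.add_assoc, Nat.choose_succ_succ', Nat.add_one_mul]
    lia

/-- If `3 ≤ r ≤ ℓ ≤ k−2`, then `(k−ℓ−1)/2 ≤ (C(k−1, r−1) − C(ℓ, r−1))/r`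
as rational numbers. -/
theorem half_le_choose_diff_div (k r ℓ : ℕ) (hr : 3 ≤ r) (hrl : r ≤ ℓ)
    (hlk : ℓ + 2 ≤ k) :
    ((k : ℚ) - (ℓ : ℚ) - 1) / 2 ≤
      ((Nat.choose (k - 1) (r - 1) : ℚ) - (Nat.choose ℓ (r - 1) : ℚ)) / (r : ℚ) := by
  obtain ⟨s, rfl⟩ : ∃ s, r = s + 2 := ⟨r - 2, by lia⟩
  obtain ⟨d, rfl⟩ : ∃ d, k = ℓ + d + 1 := ⟨k - 1 - ℓ, by lia⟩
  have hchoose : s + 1 ≤ ℓ.choose s := by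
    simpa using Nat.choose_le_choose s (show s + 1 ≤ ℓ by lia)
  have hdiff : ℓ.choose (s + 1) + d * (s + 1) ≤ (ℓ + d).choose (s + 1) :=
    (Nat.add_le_add_left (Nat.mul_le_mul_left d hchoose) _).trans
      (choose_succ_add_mul_choose_le ℓ s d)
  have hdiff' : (ℓ.choose (s + 1) : ℚ) + d * (s + 1) ≤ (ℓ + d).choose (s + 1) := by
    exact_mod_cast hdiff
  have hds : (0 : ℚ) ≤ d * s := by positivity
  rw [show ℓ + d + 1 - 1 = ℓ + d by lia, show s + 2 - 1 = s + 1 by lia,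
    div_le_div_iff₀ (by norm_num) (by positivity)]
  push_cast
  linarith
end
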